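/- arXiv:2411.11298 — 2 statements merged into one kernel-verified Lean document; each statement's English description precedes it below -/
import Mathlib

section
/- There is a constant C > 0 such that for every string w of length n ≥ 2, δ(BBWT(w)) ≤ C · δ(w) · (log₂ n)⁶. -/
/-! Basic definitions: strings as `List α`, rotations, runs, BWT, Lyndon
factorization, ω-order, bijective BWT, and Fibonacci words. -/

variable {α : Type*}

/-- Left cyclic rotation by one symbol. -/
def rot (x : List α) : List α := x.drop 1 ++ x.take 1

/-- The list of all `|x|` cyclic rotations of `x`. -/
def rotations (x : List α) : List (List α) :=
  (List.range x.length).map (fun i => rot^[i] x)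

/-- ρ: the number of maximal runs of equal consecutive symbols. -/
def runsCount [DecidableEq α] : List α → ℕ
  | [] => 0
  | [_] => 1
  | a :: b :: t => (if a = b then 0 else 1) + runsCount (b :: t)

/-- The Burrows–Wheeler transform: last symbols of the lexicographically
sorted rotations. -/
def BWT [LinearOrder α] (w : List α) : List α :=
  (List.insertionSort (· ≤ ·) (rotations w)).filterMap List.getLast?

/-- The lexicographically smallest rotation of `x`. -/
def lexMinRotation [LinearOrder α] (x : List α) : List α :=
  (List.insertionSort (· ≤ ·) (rotations x)).headD x

/-- A Lyndon word: nonempty and strictly smaller than all its proper rotations. -/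
def IsLyndon [LinearOrder α] (x : List α) : Prop :=
  x ≠ [] ∧ ∀ i < x.length, 0 < i → x < rot^[i] x

instance [LinearOrder α] : DecidablePred (IsLyndon (α := α)) := fun _ =>
  inferInstanceAs (Decidable (_ ∧ _))

/-- The longest prefix of `w` that is a Lyndon word (the first Lyndon factor). -/
def firstLyndonFactor [LinearOrder α] (w : List α) : List α :=
  (((List.range (w.length + 1)).map (fun i => w.take i)).filter
    (fun x => decide (IsLyndon x))).getLastD []

def lyndonFactAux [LinearOrder α] : ℕ → List α → List (List α)
  | 0, _ => []
  | _, [] => []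
  | fuel+1, w =>
      let p := firstLyndonFactor w
      if p.isEmpty then [] else p :: lyndonFactAux fuel (w.drop p.length)

/-- The Lyndon factorization of `w`: repeatedly peel off the longest Lyndon
prefix (equivalently, the unique nonincreasing factorization into Lyndon words). -/
def lyndonFactorization [LinearOrder α] (w : List α) : List (List α) :=
  lyndonFactAux w.length w

/-- `listPow x n = x^n`. -/
def listPow (x : List α) : ℕ → List α
  | 0 => []
  | n+1 => x ++ listPow x n

/-- ω-order: `x ≤ω y` iff `x^∞ ≤ y^∞` lexicographically; comparing the
equal-length words `x^{|y|}` and `y^{|x|}` is equivalent. -/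
def omegaLE [LinearOrder α] (x y : List α) : Prop :=
  listPow x y.length ≤ listPow y x.length

instance [LinearOrder α] : DecidableRel (omegaLE (α := α)) := fun _ _ =>
  inferInstanceAs (Decidable (_ ≤ _))

/-- The bijective Burrows–Wheeler transform: last symbols of all rotations of
all Lyndon factors of `w`, sorted in ω-order. -/
def BBWT [LinearOrder α] (w : List α) : List α :=
  (List.insertionSort omegaLE
    (((lyndonFactorization w).map rotations).flatten)).filterMap List.getLast?

/-- Fibonacci words over symbols `a < b`: `F 0 = b`, `F 1 = a`,
`F (i+2) = F (i+1) ++ F i`. -/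
def fibWordG (a b : α) : ℕ → List α
  | 0 => [b]
  | 1 => [a]
  | n+2 => fibWordG a b (n+1) ++ fibWordG a b n

/-- Fibonacci words over `Fin 2` with `a = 0 < b = 1`. -/
def fibWord : ℕ → List (Fin 2) := fibWordG 0 1

/-- The number of distinct length-`k` substrings of `w`. -/
def numDistinctSubstr [DecidableEq α] (w : List α) (k : ℕ) : ℕ :=
  (((List.range (w.length - k + 1)).map (fun i => (w.drop i).take k)).dedup).length

/-- The substring complexity measure `δ(w) = max_{1 ≤ k ≤ |w|} S_k(w)/k`. -/
def deltaQ [DecidableEq α] (w : List α) : ℚ :=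
  ((List.range w.length).map
    (fun k => (numDistinctSubstr w (k+1) : ℚ) / (k+1))).foldr max 0

/-! ### Heavy and light edges -/

lemma two_pow_card_halvings_mul_le (f : ℕ → ℕ) (hf : ∀ d, f (d + 1) ≤ f d) (n : ℕ) :
    2 ^ ((Finset.range n).filter (fun d => 2 * f (d + 1) ≤ f d)).card * f n ≤ f 0 := by
  induction n with
  | zero => simp
  | succ n ih =>
    rw [Finset.range_add_one, Finset.filter_insert]
    split_ifs with h
    · rw [Finset.card_insert_of_notMem (by simp)]
      calc _ = 2 ^ ((Finset.range n).filter (fun d => 2 * f (d + 1) ≤ f d)).card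
              * (2 * f (n + 1)) := by ring
        _ ≤ _ := (Nat.mul_le_mul_left _ h).trans ih
    · exact (Nat.mul_le_mul_left _ (hf n)).trans ih

/-- The translate of a bi-infinite word. -/
def shiftWord (z : ℤ) (g : ℤ → α) : ℤ → α := fun k => g (k + z)

/-- The length-`K` window at the origin of a bi-infinite word. -/
def window (K : ℕ) (g : ℤ → α) : Fin K → α := fun i => g i

open Classical in
/-- The number of words in `X` with the same `d` symbols as `g` immediately left of the origin. -/
noncomputable def leftCount (X : Finset (ℤ → α)) (d : ℕ) (g : ℤ → α) : ℕ :=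
  (X.filter (fun h => ∀ k : ℕ, k < d → h (-(k + 1)) = g (-(k + 1)))).card

/-- The depths `d < l` at which the left context of `g` follows a light edge. -/
noncomputable def lightDepths (X : Finset (ℤ → α)) (l : ℕ) (g : ℤ → α) : Finset ℕ :=
  (Finset.range l).filter (fun d => 2 * leftCount X (d + 1) g ≤ leftCount X d g)

lemma leftCount_congr (X : Finset (ℤ → α)) {d : ℕ} {g g' : ℤ → α}
    (h : ∀ k : ℕ, k < d → g (-(k + 1)) = g' (-(k + 1))) :
    leftCount X d g = leftCount X d g' := by
  unfold leftCount
  congr 1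
  ext f
  simp only [Finset.mem_filter, and_congr_right_iff]
  intro _
  exact forall₂_congr fun k hk => by rw [h k hk]

lemma lightDepths_congr (X : Finset (ℤ → α)) {l : ℕ} {g g' : ℤ → α}
    (h : ∀ k : ℕ, k < l → g (-(k + 1)) = g' (-(k + 1))) :
    lightDepths X l g = lightDepths X l g' := by
  unfold lightDepths
  apply Finset.filter_congr
  intro d hd
  rw [Finset.mem_range] at hd
  rw [leftCount_congr X (d := d + 1) fun k hk => h k (by omega),
    leftCount_congr X (d := d) fun k hk => h k (by omega)]

lemma card_lightDepths_le (X : Finset (ℤ → α)) (l : ℕ) {g : ℤ → α} (hg : g ∈ X) :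
    (lightDepths X l g).card ≤ Nat.log 2 X.card := by
  classical
  have h := two_pow_card_halvings_mul_le (fun d => leftCount X d g) (fun d => by
    apply Finset.card_le_card
    intro f
    simp only [Finset.mem_filter]
    exact fun hf => ⟨hf.1, fun k hk => hf.2 k (by omega)⟩) l
  have hpos : 1 ≤ leftCount X l g :=
    Finset.card_pos.2 ⟨g, Finset.mem_filter.2 ⟨hg, fun _ _ => rfl⟩⟩
  have h0 : leftCount X 0 g = X.card := by simp [leftCount]
  apply Nat.le_log_of_pow_le (by norm_num)
  rw [← h0]
  exact (Nat.le_mul_of_pos_right _ hpos).trans h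

lemma light_or_light (X : Finset (ℤ → α)) {d : ℕ} {g g' : ℤ → α}
    (h : ∀ k : ℕ, k < d → g (-(k + 1)) = g' (-(k + 1))) (hne : g (-(d + 1)) ≠ g' (-(d + 1))) :
    2 * leftCount X (d + 1) g ≤ leftCount X d g ∨
      2 * leftCount X (d + 1) g' ≤ leftCount X d g' := by
  classical
  have hadd : leftCount X (d + 1) g + leftCount X (d + 1) g' ≤ leftCount X d g := by
    unfold leftCount
    rw [← Finset.card_union_of_disjoint]
    · apply Finset.card_le_card
      intro f
      simp only [Finset.mem_union, Finset.mem_filter]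
      rintro (hf | hf)
      · exact ⟨hf.1, fun k hk => hf.2 k (by omega)⟩
      · exact ⟨hf.1, fun k hk => (hf.2 k (by omega)).trans (h k hk).symm⟩
    · rw [Finset.disjoint_left]
      intro f
      simp only [Finset.mem_filter]
      exact fun hf hf' => hne ((hf.2 d (by omega)).symm.trans (hf'.2 d (by omega)))
  rw [← leftCount_congr X h]
  omega

open Classical in
/-- At scale `l`, the irreducible pairs number at most a logarithmic factor times the number of
windows of length `3 * l` divided by `l`. -/
lemma card_irreducible_mul_le (X : Finset (ℤ → α))
    (hX : ∀ g ∈ X, ∀ z, shiftWord z g ∈ X) (P : Finset ℕ) (x : ℕ → ℤ → α) (l : ℕ)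
    (hmem : ∀ p ∈ P, x p ∈ X ∧ x (p + 1) ∈ X)
    (hirr : ∀ p ∈ P, x p (-1) ≠ x (p + 1) (-1))
    (hagree : ∀ p ∈ P, ∀ k : ℕ, k < l → x p k = x (p + 1) k)
    (hinj : ∀ p ∈ P, ∀ q ∈ P, (∀ k : ℕ, k < 2 * l → x p k = x q k) → p = q)
    (hinj' : ∀ p ∈ P, ∀ q ∈ P, (∀ k : ℕ, k < 2 * l → x (p + 1) k = x (q + 1) k) → p = q) :
    P.card * l ≤ 2 * Nat.log 2 X.card * (X.image (window (3 * l))).card := by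
  have hlight : ∀ p ∈ P, ∀ d < l, ∃ b : Bool,
      d ∈ lightDepths X l (shiftWord d (x (if b then p else p + 1))) := by
    intro p hp d hd
    rcases light_or_light X (d := d) (g := shiftWord d (x p)) (g' := shiftWord d (x (p + 1)))
      (fun k hk => by
        have := hagree p hp (d - (k + 1)) (by omega)
        simp only [shiftWord]
        rw [show (-((k : ℤ) + 1) + d) = ((d - (k + 1) : ℕ) : ℤ) by omega]
        exact this)
      (by
        simp only [shiftWord]
        rw [show (-((d : ℤ) + 1) + d) = -1 by omega]
        exact hirr p hp) with h | h
    · exact ⟨true, Finset.mem_filter.2 ⟨Finset.mem_range.2 hd, by simpa using h⟩⟩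
    · exact ⟨false, Finset.mem_filter.2 ⟨Finset.mem_range.2 hd, by simpa using h⟩⟩
  choose! b hb using hlight
  set G : ℕ × ℕ → ℤ → α := fun e =>
    shiftWord e.2 (x (if b e.1 e.2 then e.1 else e.1 + 1)) with hG
  have hGX : ∀ e ∈ P ×ˢ Finset.range l, G e ∈ X := by
    rintro ⟨p, d⟩ he
    simp only [Finset.mem_product, Finset.mem_range] at he
    refine hX _ ?_ _
    split_ifs
    exacts [(hmem p he.1).1, (hmem p he.1).2]
  set W : ℕ × ℕ → Fin (3 * l) → α := fun e => window (3 * l) (shiftWord (-l) (G e)) with hW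
  have hWeq : ∀ e e', W e = W e' → ∀ k : ℤ, -l ≤ k → k < 2 * l → G e k = G e' k := by
    intro e e' h k hk hk'
    have := congrFun h ⟨(k + l).toNat, by omega⟩
    simp only [hW, window, shiftWord] at this
    rwa [show (((k + l).toNat : ℤ) + -l) = k by omega] at this
  rw [← Finset.card_range l, ← Finset.card_product, Finset.card_range]
  apply Finset.card_le_mul_card_image_of_maps_to (f := W)
  · intro e he
    exact Finset.mem_image_of_mem _ (hX _ (hGX e he) _)
  · intro w _
    rcases Finset.eq_empty_or_nonempty ((P ×ˢ Finset.range l).filter (fun e => W e = w))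
      with hE | ⟨e₀, he₀⟩
    · rw [hE]; simp
    rw [Finset.mem_filter] at he₀
    calc _ ≤ ((Finset.univ : Finset Bool) ×ˢ lightDepths X l (G e₀)).card := by
          apply Finset.card_le_card_of_injOn (fun e => (b e.1 e.2, e.2))
          · intro e he
            simp only [Finset.coe_filter, Set.mem_ofPred_eq, Finset.mem_product,
              Finset.mem_range] at he
            simp only [Finset.coe_product, Set.mem_prod, Finset.coe_univ, Set.mem_univ, true_and,
              Finset.mem_coe]
            rw [← lightDepths_congr X (g := G e) fun k hk =>
              hWeq e e₀ (he.2.trans he₀.2.symm) _ (by omega) (by omega)]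
            exact hb e.1 he.1.1 e.2 he.1.2
          · rintro ⟨p, d⟩ he ⟨p', d'⟩ he' heq
            simp only [Finset.coe_filter, Set.mem_ofPred_eq, Finset.mem_product,
              Finset.mem_range] at he he'
            simp only [Prod.mk.injEq] at heq
            obtain ⟨hbb, rfl⟩ := heq
            have key : ∀ k : ℕ, k < 2 * l → x (if b p d then p else p + 1) k =
                x (if b p d then p' else p' + 1) k := by
              intro k hk
              have := hWeq _ _ (he.2.trans he'.2.symm) (k - d) (by omega) (by omega)
              simpa [hG, shiftWord, ← hbb] using this
            have : p = p' := by
              cases hbv : b p d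
              · exact hinj' p he.1.1 p' he'.1.1 (by simpa [hbv] using key)
              · exact hinj p he.1.1 p' he'.1.1 (by simpa [hbv] using key)
            rw [this]
      _ = 2 * (lightDepths X l (G e₀)).card := by simp [Finset.card_product]
      _ ≤ _ := Nat.mul_le_mul_left _ (card_lightDepths_le X l (hGX e₀ he₀.1))

open Classical in
/-- Summing over dyadic scales bounds the number of symbol changes in the column preceding a
sorted sequence of words. -/
lemma card_changes_le (X : Finset (ℤ → α))
    (hX : ∀ g ∈ X, ∀ z, shiftWord z g ∈ X) (x : ℕ → ℤ → α) (N J : ℕ) (D : ℝ)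
    (hD : ∀ K, 0 < K → ((X.image (window K)).card : ℝ) ≤ K * D)
    (hmem : ∀ p < N, x p ∈ X)
    (hconv : ∀ p q r, p ≤ q → q ≤ r → r < N → ∀ L : ℕ,
      (∀ k : ℕ, k < L → x p k = x r k) → ∀ k : ℕ, k < L → x p k = x q k)
    (hlcp : ∀ p, p + 1 < N → x p (-1) ≠ x (p + 1) (-1) →
      ∃ k : ℕ, k < 2 ^ J ∧ x p k ≠ x (p + 1) k) :
    (((Finset.range (N - 1)).filter (fun p => x p (-1) ≠ x (p + 1) (-1))).card : ℝ) ≤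
      D * (1 + 6 * J * Nat.log 2 X.card) := by
  set C := (Finset.range (N - 1)).filter (fun p => x p (-1) ≠ x (p + 1) (-1)) with hC
  have hsep : ∀ L : ℕ, ∀ p q, p < q → q + 1 < N → (∃ k : ℕ, k < L ∧ x p k ≠ x (p + 1) k) →
      (∃ k : ℕ, k < L ∧ x q k ≠ x (q + 1) k) →
      (¬ ∀ k : ℕ, k < L → x p k = x q k) ∧ ¬ ∀ k : ℕ, k < L → x (p + 1) k = x (q + 1) k := by
    intro L p q hpq hq ⟨k, hk, hkp⟩ ⟨k', hk', hkq⟩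
    refine ⟨fun h => hkp (hconv p (p + 1) q (by omega) (by omega) (by omega) L h k hk),
      fun h => hkq ?_⟩
    have h1 := hconv (p + 1) q (q + 1) (by omega) (by omega) hq L h k' hk'
    rw [← h1, h k' hk']
  set P₀ := C.filter (fun p => x p (0 : ℕ) ≠ x (p + 1) (0 : ℕ)) with hP₀
  set P : ℕ → Finset ℕ := fun j => C.filter (fun p => (∀ k : ℕ, k < 2 ^ j → x p k = x (p + 1) k) ∧
    ∃ k : ℕ, k < 2 * 2 ^ j ∧ x p k ≠ x (p + 1) k) with hP
  have hC_lt : ∀ p ∈ C, p + 1 < N := by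
    intro p hp
    have := Finset.mem_range.1 (Finset.mem_filter.1 hp).1
    omega
  have hcover : C ⊆ P₀ ∪ (Finset.range J).biUnion P := by
    intro p hp
    have hex := hlcp p (hC_lt p hp) (Finset.mem_filter.1 hp).2
    have hex' : ∃ k : ℕ, x p k ≠ x (p + 1) k := ⟨_, hex.choose_spec.2⟩
    set m := Nat.find hex' with hm
    have hm1 : x p m ≠ x (p + 1) m := Nat.find_spec hex'
    have hm2 : ∀ k < m, x p k = x (p + 1) k := fun k hk => not_not.1 (Nat.find_min hex' hk)
    have hmJ : m < 2 ^ J := (Nat.find_min' hex' hex.choose_spec.2).trans_lt hex.choose_spec.1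
    rw [Finset.mem_union]
    rcases Nat.eq_zero_or_pos m with h0 | hpos
    · left
      rw [h0] at hm1
      exact Finset.mem_filter.2 ⟨hp, hm1⟩
    · right
      rw [Finset.mem_biUnion]
      refine ⟨Nat.log 2 m, Finset.mem_range.2 (Nat.log_lt_of_lt_pow hpos.ne' hmJ),
        Finset.mem_filter.2 ⟨hp, fun k hk => hm2 k ?_, m, ?_, hm1⟩⟩
      · exact hk.trans_le (Nat.pow_log_le_self 2 hpos.ne')
      · have := Nat.lt_pow_succ_log_self (b := 2) (by norm_num) m
        rw [Nat.succ_eq_add_one, pow_succ] at this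
        omega
  have hP₀card : (P₀.card : ℝ) ≤ D := by
    have h1 : P₀.card ≤ (X.image (window 1)).card := by
      apply Finset.card_le_card_of_injOn (fun p => window 1 (x p))
      · intro p hp
        have hp' := hC_lt p (Finset.mem_filter.1 hp).1
        exact Finset.mem_coe.2 (Finset.mem_image_of_mem _ (hmem p (by omega)))
      · have main : ∀ p ∈ P₀, ∀ q ∈ P₀, p < q → window 1 (x p) ≠ window 1 (x q) := by
          intro p hp q hq hpq heq
          refine (hsep 1 p q hpq (hC_lt q (Finset.mem_filter.1 hq).1)
            ⟨0, one_pos, (Finset.mem_filter.1 hp).2⟩ ⟨0, one_pos, (Finset.mem_filter.1 hq).2⟩).1 ?_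
          intro k hk
          exact congrFun heq ⟨k, hk⟩
        intro p hp q hq heq
        rcases lt_trichotomy p q with h | h | h
        · exact absurd heq (main p hp q hq h)
        · exact h
        · exact absurd heq.symm (main q hq p hp h)
    calc (P₀.card : ℝ) ≤ ((X.image (window 1)).card : ℝ) := by exact_mod_cast h1
      _ ≤ D := by simpa using hD 1 one_pos
  have hPcard : ∀ j, ((P j).card : ℝ) ≤ D * (6 * Nat.log 2 X.card) := by
    intro j
    have hlpos : (0 : ℝ) < (2 ^ j : ℕ) := by positivity
    have key := card_irreducible_mul_le X hX (P j) x (2 ^ j)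
      (fun p hp => by
        have hp' := hC_lt p (Finset.mem_filter.1 hp).1
        exact ⟨hmem p (by omega), hmem _ hp'⟩)
      (fun p hp => (Finset.mem_filter.1 (Finset.mem_filter.1 hp).1).2)
      (fun p hp => (Finset.mem_filter.1 hp).2.1)
      (fun p hp q hq h => by
        have hp' := hC_lt p (Finset.mem_filter.1 hp).1
        have hq' := hC_lt q (Finset.mem_filter.1 hq).1
        rcases lt_trichotomy p q with h' | h' | h'
        · exact absurd h (hsep _ p q h' hq' (Finset.mem_filter.1 hp).2.2
            (Finset.mem_filter.1 hq).2.2).1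
        · exact h'
        · exact absurd (fun k hk => (h k hk).symm) (hsep _ q p h' hp' (Finset.mem_filter.1 hq).2.2
            (Finset.mem_filter.1 hp).2.2).1)
      (fun p hp q hq h => by
        have hp' := hC_lt p (Finset.mem_filter.1 hp).1
        have hq' := hC_lt q (Finset.mem_filter.1 hq).1
        rcases lt_trichotomy p q with h' | h' | h'
        · exact absurd h (hsep _ p q h' hq' (Finset.mem_filter.1 hp).2.2
            (Finset.mem_filter.1 hq).2.2).2
        · exact h'
        · exact absurd (fun k hk => (h k hk).symm) (hsep _ q p h' hp' (Finset.mem_filter.1 hq).2.2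
            (Finset.mem_filter.1 hp).2.2).2)
    have key' : ((P j).card : ℝ) * (2 ^ j : ℕ) ≤
        2 * Nat.log 2 X.card * ((X.image (window (3 * 2 ^ j))).card : ℝ) := by
      exact_mod_cast key
    have hw := hD (3 * 2 ^ j) (by positivity)
    have h3 : ((P j).card : ℝ) * (2 ^ j : ℕ) ≤ D * (6 * Nat.log 2 X.card) * (2 ^ j : ℕ) :=
      calc _ ≤ 2 * (Nat.log 2 X.card : ℝ) * ((3 * 2 ^ j : ℕ) * D) :=
            key'.trans (mul_le_mul_of_nonneg_left hw (by positivity))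
        _ = _ := by push_cast; ring
    exact le_of_mul_le_mul_right h3 hlpos
  calc (C.card : ℝ) ≤ ((P₀.card + ∑ j ∈ Finset.range J, (P j).card : ℕ) : ℝ) := by
        exact_mod_cast (Finset.card_le_card hcover).trans ((Finset.card_union_le _ _).trans
          (Nat.add_le_add_left Finset.card_biUnion_le _))
    _ = P₀.card + ∑ j ∈ Finset.range J, ((P j).card : ℝ) := by push_cast; rfl
    _ ≤ D + ∑ j ∈ Finset.range J, D * (6 * Nat.log 2 X.card) :=
        add_le_add hP₀card (Finset.sum_le_sum fun j _ => hPcard j)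
    _ = _ := by rw [Finset.sum_const, Finset.card_range, nsmul_eq_mul]; ring

/-! ### Lyndon words by positions -/

/-- The symbols of `u` at positions `a, …, b - 1` form a word that is smaller than each of its
proper suffixes, with the deciding symbol inside the suffix. -/
def LyndonOn [LT α] (u : ℕ → α) (a b : ℕ) : Prop :=
  a < b ∧ ∀ r, a < r → r < b →
    ∃ q, r + q < b ∧ (∀ k < q, u (a + k) = u (r + k)) ∧ u (a + q) < u (r + q)

lemma LyndonOn.transfer [LT α] {u u' : ℕ → α} {a a' n : ℕ} (h : LyndonOn u a (a + n))
    (huu : ∀ k < n, u (a + k) = u' (a' + k)) : LyndonOn u' a' (a' + n) := by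
  refine ⟨by have := h.1; omega, fun r hr hr' => ?_⟩
  obtain ⟨q, hq, hq1, hq2⟩ := h.2 (a + (r - a')) (by omega) (by omega)
  have e : ∀ k, r - a' + k < n → u (a + (r - a') + k) = u' (r + k) := by
    intro k hk
    rw [add_assoc, huu _ hk]
    congr 1
    omega
  refine ⟨q, by omega, fun k hk => ?_, ?_⟩
  · rw [← huu k (by omega), hq1 k hk, e k (by omega)]
  · rw [← huu q (by omega), ← e q (by omega)]
    exact hq2

lemma LyndonOn.overlap [LinearOrder α] {u : ℕ → α} {a b c d : ℕ} (h : LyndonOn u a b)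
    (h' : LyndonOn u c d) (hac : a ≤ c) (hcb : c < b) (hbd : b ≤ d) : LyndonOn u a d := by
  refine ⟨by omega, fun r hr hrd => ?_⟩
  rcases lt_or_ge r b with hrb | hrb
  · obtain ⟨q, hq, h1, h2⟩ := h.2 r hr hrb
    exact ⟨q, by omega, h1, h2⟩
  · obtain ⟨q, hq, h1, h2⟩ := h'.2 r (by omega) hrd
    rcases hac.eq_or_lt with rfl | hac
    · exact ⟨q, hq, h1, h2⟩
    obtain ⟨q', hq', h1', h2'⟩ := h.2 c hac hcb
    rcases lt_trichotomy q q' with hlt | rfl | hlt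
    · exact ⟨q, hq, fun k hk => (h1' k (by omega)).trans (h1 k hk), by rw [h1' q hlt]; exact h2⟩
    · exact ⟨q, hq, fun k hk => (h1' k hk).trans (h1 k hk), h2'.trans h2⟩
    · exact ⟨q', by omega, fun k hk => (h1' k hk).trans (h1 k (by omega)), by
        rw [← h1 q' hlt]; exact h2'⟩

lemma rot_eq_rotate (x : List α) : rot x = x.rotate 1 := by
  cases x with
  | nil => rfl
  | cons a t => rw [List.rotate_eq_drop_append_take (by simp)]; rfl

lemma iterate_rot (x : List α) (i : ℕ) : rot^[i] x = x.rotate i := by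
  induction i with
  | zero => simp
  | succ i ih => rw [Function.iterate_succ_apply', ih, rot_eq_rotate, List.rotate_rotate]

lemma length_iterate_rot (x : List α) (i : ℕ) : (rot^[i] x).length = x.length := by
  rw [iterate_rot, List.length_rotate]

lemma getD_iterate_rot (x : List α) (d : α) (i : ℕ) {k : ℕ} (hk : k < x.length) :
    (rot^[i] x).getD k d = x.getD ((k + i) % x.length) d := by
  rw [iterate_rot, List.getD_eq_getElem?_getD, List.getD_eq_getElem?_getD,
    List.getElem?_rotate hk]

lemma lt_iff_getD [LinearOrder α] (d : α) {x y : List α} (h : x.length = y.length) :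
    x < y ↔ ∃ q < x.length, (∀ k < q, x.getD k d = y.getD k d) ∧ x.getD q d < y.getD q d := by
  rw [List.lt_iff_exists]
  constructor
  · rintro (⟨-, h'⟩ | ⟨i, h₁, h₂, h3, h4⟩)
    · omega
    · refine ⟨i, h₁, fun k hk => ?_, ?_⟩
      · rw [List.getD_eq_getElem _ _ (by omega), List.getD_eq_getElem _ _ (by omega)]
        exact h3 k hk
      · rwa [List.getD_eq_getElem _ _ (by omega), List.getD_eq_getElem _ _ (by omega)]
  · rintro ⟨q, hq, h3, h4⟩
    refine Or.inr ⟨q, hq, by omega, fun k hk => ?_, ?_⟩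
    · have := h3 k hk
      rwa [List.getD_eq_getElem _ _ (by omega), List.getD_eq_getElem _ _ (by omega)] at this
    · rwa [List.getD_eq_getElem _ _ (by omega), List.getD_eq_getElem _ _ (by omega)] at h4

lemma isLyndon_iff_lyndonOn [LinearOrder α] (d : α) (x : List α) :
    IsLyndon x ↔ LyndonOn (fun i => x.getD i d) 0 x.length := by
  constructor
  · rintro ⟨hne, hx⟩
    have hpos := List.length_pos_of_ne_nil hne
    have hrot : ∀ i < x.length, 0 < i → ∃ q < x.length,
        (∀ k < q, x.getD k d = x.getD ((k + i) % x.length) d) ∧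
          x.getD q d < x.getD ((q + i) % x.length) d := by
      intro i hi hi0
      obtain ⟨q, hq, h1, h2⟩ := (lt_iff_getD d (length_iterate_rot x i).symm).1 (hx i hi hi0)
      refine ⟨q, hq, fun k hk => ?_, ?_⟩
      · rw [h1 k hk, getD_iterate_rot _ _ _ (by omega)]
      · rwa [getD_iterate_rot _ _ _ hq] at h2
    refine ⟨hpos, fun r hr hrn => ?_⟩
    simp only [Nat.zero_add]
    obtain ⟨q, hq, h1, h2⟩ := hrot r hrn hr
    rcases lt_or_ge (r + q) x.length with hlt | hge
    · refine ⟨q, hlt, fun k hk => ?_, ?_⟩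
      · rw [h1 k hk, Nat.mod_eq_of_lt (by omega), add_comm]
      · rwa [Nat.mod_eq_of_lt (by omega), add_comm] at h2
    · exfalso
      have border : ∀ k < x.length - r, x.getD k d = x.getD (k + r) d := by
        intro k hk
        rw [h1 k (by omega), Nat.mod_eq_of_lt (by omega)]
      obtain ⟨q', hq', h1', h2'⟩ := hrot (x.length - r) (by omega) (by omega)
      have wrap : ∀ k, r ≤ k → k < x.length → (k + (x.length - r)) % x.length = k - r := by
        intro k hk hk'
        rw [Nat.mod_eq_sub_mod (by omega), Nat.mod_eq_of_lt (by omega)]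
        omega
      have hq'r : q' < r := by
        by_contra hcon
        rw [wrap q' (by omega) hq', border (q' - r) (by omega),
          show q' - r + r = q' by omega] at h2'
        exact lt_irrefl _ h2'
      rw [Nat.mod_eq_of_lt (by omega)] at h2'
      have wrap' : ∀ k, x.length - r ≤ k → k ≤ q → (k + r) % x.length = k - (x.length - r) := by
        intro k hk hk'
        rw [Nat.mod_eq_sub_mod (by omega), Nat.mod_eq_of_lt (by omega)]
        omega
      rw [wrap' q (by omega) le_rfl] at h2
      rcases lt_trichotomy (q - (x.length - r)) q' with hlt | heq | hgt
      · have := h1' _ hlt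
        rw [Nat.mod_eq_of_lt (by omega),
          show q - (x.length - r) + (x.length - r) = q by omega] at this
        rw [this] at h2
        exact lt_irrefl _ h2
      · rw [heq] at h2
        rw [show q' + (x.length - r) = q by omega] at h2'
        exact lt_asymm h2 h2'
      · have := h1 (q' + (x.length - r)) (by omega)
        rw [wrap' _ (by omega) (by omega),
          show q' + (x.length - r) - (x.length - r) = q' by omega] at this
        rw [this] at h2'
        exact lt_irrefl _ h2'
  · rintro ⟨hpos, h⟩
    refine ⟨List.ne_nil_of_length_pos hpos, fun i hi hi0 => ?_⟩
    obtain ⟨q, hq, h1, h2⟩ := h i hi0 hi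
    simp only [Nat.zero_add] at h1 h2
    rw [lt_iff_getD d (length_iterate_rot x i).symm]
    refine ⟨q, by omega, fun k hk => ?_, ?_⟩
    · rw [getD_iterate_rot _ _ _ (by omega), Nat.mod_eq_of_lt (by omega), h1 k hk, add_comm]
    · rwa [getD_iterate_rot _ _ _ (by omega), Nat.mod_eq_of_lt (by omega), add_comm q i]

/-! ### The Lyndon factorization -/

lemma exists_getLastD_filter_map_range {β : Type*} (f : ℕ → β) (p : β → Bool) (z : β) (n : ℕ)
    (h : ∃ i < n, p (f i)) :
    ∃ e < n, (((List.range n).map f).filter p).getLastD z = f e ∧ p (f e) ∧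
      ∀ e', e < e' → e' < n → ¬ p (f e') := by
  induction n with
  | zero => simp at h
  | succ n ih =>
    rw [List.range_succ, List.map_append, List.filter_append]
    by_cases hn : p (f n)
    · exact ⟨n, by omega, by simp [hn], hn, fun e' _ _ => by omega⟩
    · obtain ⟨i, hi, hpi⟩ := h
      have hin : i ≠ n := fun e => hn (e ▸ hpi)
      obtain ⟨e, he, h1, h2, h3⟩ := ih ⟨i, by omega, hpi⟩
      refine ⟨e, by omega, by simpa [hn] using h1, h2, fun e' he' hlt => ?_⟩
      rcases Nat.lt_succ_iff_lt_or_eq.1 hlt with h' | rfl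
      · exact h3 e' he' h'
      · exact hn

lemma firstLyndonFactor_spec [LinearOrder α] {w : List α} (hw : w ≠ []) :
    ∃ e ≤ w.length, firstLyndonFactor w = w.take e ∧ IsLyndon (w.take e) ∧
      ∀ e', e < e' → e' ≤ w.length → ¬ IsLyndon (w.take e') := by
  obtain ⟨e, he, h1, h2, h3⟩ := exists_getLastD_filter_map_range (fun i => w.take i)
    (fun x => decide (IsLyndon x)) [] (w.length + 1) ⟨1, by
      have := List.length_pos_of_ne_nil hw
      omega, by
      obtain ⟨a, t, rfl⟩ := List.exists_cons_of_ne_nil hw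
      exact decide_eq_true ⟨by simp, fun i hi h0 => by simp at hi; omega⟩⟩
  exact ⟨e, by omega, h1, of_decide_eq_true h2,
    fun e' he' hle hL => h3 e' he' (by omega) (decide_eq_true hL)⟩

lemma lyndonFactAux_spec [LinearOrder α] (fuel : ℕ) (w : List α) (hw : w.length ≤ fuel) :
    (lyndonFactAux fuel w).flatten = w ∧
      ∀ A L B, lyndonFactAux fuel w = A ++ L :: B → IsLyndon L ∧
        ∀ e, L.length < e → e ≤ (L ++ B.flatten).length →
          ¬ IsLyndon ((L ++ B.flatten).take e) := by
  induction fuel generalizing w with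
  | zero =>
    obtain rfl := List.eq_nil_of_length_eq_zero (Nat.le_zero.1 hw)
    simp [lyndonFactAux]
  | succ fuel ih =>
    rcases eq_or_ne w [] with rfl | hne
    · simp [lyndonFactAux]
    obtain ⟨e, he, h1, h2, h3⟩ := firstLyndonFactor_spec hne
    have hlen : (w.take e).length = e := by simp [he]
    have hpos : 0 < e := hlen ▸ List.length_pos_of_ne_nil h2.1
    have hunf : lyndonFactAux (fuel + 1) w = w.take e :: lyndonFactAux fuel (w.drop e) := by
      obtain ⟨a, t, rfl⟩ := List.exists_cons_of_ne_nil hne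
      simp only [lyndonFactAux]
      rw [h1, hlen, if_neg (by simpa using h2.1)]
    obtain ⟨ih1, ih2⟩ := ih (w.drop e) (by rw [List.length_drop]; omega)
    rw [hunf]
    refine ⟨by rw [List.flatten_cons, ih1, List.take_append_drop], fun A L B hAB => ?_⟩
    cases A with
    | nil =>
      simp only [List.nil_append, List.cons.injEq] at hAB
      obtain ⟨rfl, rfl⟩ := hAB
      rw [ih1, List.take_append_drop, hlen]
      exact ⟨h2, h3⟩
    | cons A₀ A =>
      simp only [List.cons_append, List.cons.injEq] at hAB
      exact ih2 A L B hAB.2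

lemma flatten_lyndonFactorization [LinearOrder α] (w : List α) :
    (lyndonFactorization w).flatten = w :=
  (lyndonFactAux_spec _ w le_rfl).1

lemma isLyndon_of_mem [LinearOrder α] {w L : List α} (h : L ∈ lyndonFactorization w) :
    IsLyndon L := by
  obtain ⟨A, B, hAB⟩ := List.append_of_mem h
  exact ((lyndonFactAux_spec _ w le_rfl).2 A L B hAB).1

lemma lyndonOn_append_append_iff [LinearOrder α] (d : α) (u v t : List α) :
    LyndonOn (fun i => (u ++ v ++ t).getD i d) u.length (u.length + v.length) ↔ IsLyndon v := by
  rw [isLyndon_iff_lyndonOn d]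
  have key : ∀ k < v.length, (u ++ v ++ t).getD (u.length + k) d = v.getD (0 + k) d := by
    intro k hk
    rw [List.getD_append _ _ _ _ (by simpa using hk),
      List.getD_append_right _ _ _ _ (by omega)]
    congr 1
    omega
  have e : v.length = 0 + v.length := by omega
  constructor
  · intro h
    rw [e]
    exact h.transfer key
  · intro h
    rw [e] at h
    exact h.transfer fun k hk => (key k hk).symm

lemma lyndonOn_factor [LinearOrder α] (d : α) {w : List α} {A B : List (List α)} {L : List α}
    (h : lyndonFactorization w = A ++ L :: B) :
    LyndonOn (fun i => w.getD i d) A.flatten.length (A.flatten.length + L.length) ∧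
      ∀ e, A.flatten.length + L.length < e → e ≤ w.length →
        ¬ LyndonOn (fun i => w.getD i d) A.flatten.length e := by
  obtain ⟨h1, h2⟩ := (lyndonFactAux_spec _ w le_rfl).2 A L B h
  have hw : w = A.flatten ++ (L ++ B.flatten) := by
    rw [← flatten_lyndonFactorization w, h]; simp
  constructor
  · have := (lyndonOn_append_append_iff d A.flatten L B.flatten).2 h1
    rwa [List.append_assoc, ← hw] at this
  · intro e he hew hL
    have hlen : w.length = A.flatten.length + (L ++ B.flatten).length := by
      conv_lhs => rw [hw]
      rw [List.length_append]
    refine h2 (e - A.flatten.length) (by omega) (by omega) ?_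
    rw [← lyndonOn_append_append_iff d A.flatten _ ((L ++ B.flatten).drop (e - A.flatten.length)),
      List.append_assoc, List.take_append_drop, ← hw, List.length_take,
      min_eq_left (by omega), show A.flatten.length + (e - A.flatten.length) = e by omega]
    exact hL

lemma exists_split_of_lt_length_flatten (A : List (List α)) {a : ℕ} (h : a < A.flatten.length) :
    ∃ A₁ L A₂, A = A₁ ++ L :: A₂ ∧ A₁.flatten.length ≤ a ∧ a < A₁.flatten.length + L.length := by
  induction A generalizing a with
  | nil => simp at h
  | cons L A ih =>
    rcases lt_or_ge a L.length with ha | ha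
    · exact ⟨[], L, A, rfl, by simp, by simpa using ha⟩
    · rw [List.flatten_cons, List.length_append] at h
      obtain ⟨A₁, L', A₂, rfl, h1, h2⟩ := ih (a := a - L.length) (by omega)
      refine ⟨L :: A₁, L', A₂, rfl, ?_, ?_⟩ <;> rw [List.flatten_cons, List.length_append] <;> omega

/-- A Lyndon substring never straddles the start of a Lyndon factor. -/
lemma not_lyndonOn_of_straddle [LinearOrder α] (d : α) {w : List α} {A B : List (List α)}
    {L : List α} (h : lyndonFactorization w = A ++ L :: B) {a b : ℕ}
    (ha : a < A.flatten.length) (hb : A.flatten.length < b) (hbw : b ≤ w.length) :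
    ¬ LyndonOn (fun i => w.getD i d) a b := by
  intro hL
  obtain ⟨A₁, L', A₂, rfl, h1, h2⟩ := exists_split_of_lt_length_flatten A ha
  obtain ⟨h3, h4⟩ := lyndonOn_factor d (A := A₁) (L := L') (B := A₂ ++ L :: B) (by rw [h]; simp)
  simp only [List.flatten_append, List.flatten_cons, List.length_append] at hb
  exact h4 b (by omega) hbw (h3.overlap hL h1 h2 (by omega))

lemma exists_start_of_mem [LinearOrder α] (d : α) {w L : List α}
    (h : L ∈ lyndonFactorization w) :
    ∃ s, s + L.length ≤ w.length ∧ (∀ k < L.length, w[s + k]? = L[k]?) ∧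
      LyndonOn (fun i => w.getD i d) s (s + L.length) ∧
      (∀ e, s + L.length < e → e ≤ w.length → ¬ LyndonOn (fun i => w.getD i d) s e) ∧
      ∀ a b, a < s → s < b → b ≤ w.length → ¬ LyndonOn (fun i => w.getD i d) a b := by
  obtain ⟨A, B, hAB⟩ := List.append_of_mem h
  have hw : w = A.flatten ++ (L ++ B.flatten) := by
    rw [← flatten_lyndonFactorization w, hAB]; simp
  refine ⟨A.flatten.length, ?_, fun k hk => ?_, (lyndonOn_factor d hAB).1,
    (lyndonOn_factor d hAB).2, fun a b ha hb hbw => not_lyndonOn_of_straddle d hAB ha hb hbw⟩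
  · conv_rhs => rw [hw]
    simp only [List.length_append]
    omega
  · conv_lhs => rw [hw]
    rw [List.getElem?_append_right (by omega), Nat.add_sub_cancel_left,
      List.getElem?_append_left hk]

/-! ### Substring complexity -/

lemma numDistinctSubstr_eq_card [DecidableEq α] (w : List α) (k : ℕ) :
    numDistinctSubstr w k =
      ((Finset.range (w.length - k + 1)).image (fun i => (w.drop i).take k)).card := by
  unfold numDistinctSubstr
  rw [← List.card_toFinset]
  congr 1

lemma le_foldr_max {l : List ℚ} {q : ℚ} (h : q ∈ l) : q ≤ l.foldr max 0 := by
  induction l with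
  | nil => simp at h
  | cons a l ih =>
    rcases List.mem_cons.1 h with rfl | h
    · exact le_max_left _ _
    · exact (ih h).trans (le_max_right _ _)

lemma foldr_max_le {l : List ℚ} {q : ℚ} (h0 : 0 ≤ q) (h : ∀ a ∈ l, a ≤ q) :
    l.foldr max 0 ≤ q := by
  induction l with
  | nil => exact h0
  | cons a l ih =>
    exact max_le (h a (by simp)) (ih fun b hb => h b (by simp [hb]))

lemma numDistinctSubstr_le_mul_deltaQ [DecidableEq α] (w : List α) {k : ℕ} (hk : 0 < k)
    (hkw : k ≤ w.length) : (numDistinctSubstr w k : ℚ) ≤ k * deltaQ w := by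
  have h : (numDistinctSubstr w k : ℚ) / k ≤ deltaQ w := by
    apply le_foldr_max
    refine List.mem_map.2 ⟨k - 1, List.mem_range.2 (by omega), ?_⟩
    have : k - 1 + 1 = k := by omega
    have h' : ((k - 1 : ℕ) : ℚ) + 1 = k := by exact_mod_cast this
    rw [this, h']
  rw [div_le_iff₀ (by exact_mod_cast hk)] at h
  linarith

lemma one_le_deltaQ [DecidableEq α] {w : List α} (hw : 0 < w.length) : 1 ≤ deltaQ w := by
  have h := numDistinctSubstr_le_mul_deltaQ w one_pos hw
  have h1 : 1 ≤ numDistinctSubstr w 1 := by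
    rw [numDistinctSubstr_eq_card]
    exact Finset.card_pos.2 (Finset.Nonempty.image ⟨0, by simp⟩ _)
  have h2 : (1 : ℚ) ≤ numDistinctSubstr w 1 := by exact_mod_cast h1
  simpa using h2.trans h

lemma card_image_range_succ_le {β : Type*} [DecidableEq β] (f : ℕ → β) (n : ℕ) :
    ((Finset.range (n + 1)).image f).card ≤
      1 + ((Finset.range n).filter (fun i => f i ≠ f (i + 1))).card := by
  induction n with
  | zero => simp
  | succ n ih =>
    have himage : (Finset.range (n + 1 + 1)).image f =
        insert (f (n + 1)) ((Finset.range (n + 1)).image f) := by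
      rw [Finset.range_add_one (n := n + 1), Finset.image_insert]
    rw [himage, Finset.range_add_one (n := n), Finset.filter_insert, ← Finset.range_add_one]
    split_ifs with h
    · rw [Finset.card_insert_of_notMem (s := Finset.filter _ _) (by simp)]
      exact (Finset.card_insert_le _ _).trans (by omega)
    · rw [Finset.insert_eq_of_mem]
      · exact ih
      · rw [← not_not.1 h]
        exact Finset.mem_image_of_mem _ (by simp)

/-- The substring complexity is at most the number of runs. -/
lemma deltaQ_le_one_add_card_changes [DecidableEq α] (u : List α) :
    deltaQ u ≤
      1 + (((Finset.range (u.length - 1)).filter (fun p => u[p]? ≠ u[p + 1]?)).card : ℚ) := by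
  apply foldr_max_le (by positivity)
  intro a ha
  obtain ⟨k, hk, rfl⟩ := List.mem_map.1 ha
  rw [List.mem_range] at hk
  set C := (Finset.range (u.length - 1)).filter (fun p => u[p]? ≠ u[p + 1]?) with hC
  have key : numDistinctSubstr u (k + 1) ≤ 1 + C.card * (k + 1) := by
    rw [numDistinctSubstr_eq_card]
    refine (card_image_range_succ_le _ _).trans (Nat.add_le_add_left ?_ 1)
    calc _ ≤ ((C ×ˢ Finset.range (k + 1)).image (fun e => e.1 - e.2)).card := by
          apply Finset.card_le_card
          intro i hi
          rw [Finset.mem_filter, Finset.mem_range] at hi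
          have hex : ∃ t < k + 1, u[i + t]? ≠ u[i + t + 1]? := by
            by_contra! hcon
            apply hi.2
            apply List.ext_getElem?
            intro t
            rw [List.getElem?_take, List.getElem?_take]
            split_ifs with ht
            · rw [List.getElem?_drop, List.getElem?_drop, hcon t ht]
              congr 1
              omega
            · rfl
          obtain ⟨t, ht, hne⟩ := hex
          rw [Finset.mem_image]
          refine ⟨(i + t, t), Finset.mem_product.2 ⟨Finset.mem_filter.2 ⟨?_, hne⟩, ?_⟩, by simp⟩
          · rw [Finset.mem_range]; omega
          · exact Finset.mem_range.2 ht
      _ ≤ _ := Finset.card_image_le.trans (by rw [Finset.card_product, Finset.card_range])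
  have hpos : (0 : ℚ) < (k : ℚ) + 1 := by positivity
  rw [div_le_iff₀ hpos]
  have key' : (numDistinctSubstr u (k + 1) : ℚ) ≤ 1 + C.card * (k + 1) := by exact_mod_cast key
  nlinarith [(Nat.cast_nonneg k : (0 : ℚ) ≤ k)]

/-! ### Counting distinct Lyndon factors -/

/-- The symbol at an integer position, absent outside of the word. -/
def optionAt (w : List α) (i : ℤ) : Option α := if 0 ≤ i then w[i.toNat]? else none

lemma optionAt_natCast (w : List α) (i : ℕ) : optionAt w i = w[i]? := by simp [optionAt]

open Classical in
lemma card_image_windows_le [DecidableEq α] {w : List α} (hw : 0 < w.length) {l : ℕ}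
    (hl : 0 < l) :
    ((((Finset.Ico (-(l : ℤ)) w.length).image
      (fun s => window (3 * l) (shiftWord s (optionAt w)))).card : ℕ) : ℝ) ≤
        l * (7 * ((deltaQ w : ℚ) : ℝ)) := by
  set F : ℤ → Fin (3 * l) → Option α := fun s => window (3 * l) (shiftWord s (optionAt w)) with hF
  have hδ : (1 : ℝ) ≤ ((deltaQ w : ℚ) : ℝ) := by exact_mod_cast one_le_deltaQ hw
  set I : Finset ℤ := (Finset.Ico (-(l : ℤ)) w.length).filter
    (fun s => 0 ≤ s ∧ s + 3 * l ≤ w.length) with hI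
  have hcover : (Finset.Ico (-(l : ℤ)) w.length).image F ⊆
      (Finset.Ico (-(l : ℤ)) 0).image F ∪
        ((Finset.Ico ((w.length : ℤ) - 3 * l) w.length).image F ∪ I.image F) := by
    intro f hf
    obtain ⟨s, hs, rfl⟩ := Finset.mem_image.1 hf
    rw [Finset.mem_Ico] at hs
    simp only [Finset.mem_union]
    by_cases h0 : s < 0
    · exact Or.inl (Finset.mem_image_of_mem _ (Finset.mem_Ico.2 ⟨hs.1, h0⟩))
    · by_cases h1 : s + 3 * l ≤ w.length
      · exact Or.inr (Or.inr (Finset.mem_image_of_mem _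
          (Finset.mem_filter.2 ⟨Finset.mem_Ico.2 hs, not_lt.1 h0, h1⟩)))
      · exact Or.inr (Or.inl (Finset.mem_image_of_mem _ (Finset.mem_Ico.2 ⟨by omega, hs.2⟩)))
  have hIcard : ((I.image F).card : ℝ) ≤ 3 * l * ((deltaQ w : ℚ) : ℝ) := by
    rcases le_or_gt (3 * l) w.length with hle | hgt
    · have h1 : (I.image F).card ≤ numDistinctSubstr w (3 * l) := by
        rw [numDistinctSubstr_eq_card]
        refine (Finset.card_le_card (t := (Finset.image (fun i => (w.drop i).take (3 * l))
          (Finset.range (w.length - 3 * l + 1))).image (fun x (i : Fin (3 * l)) => x[(i : ℕ)]?)) ?_).trans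
            Finset.card_image_le
        intro f hf
        obtain ⟨s, hs, rfl⟩ := Finset.mem_image.1 hf
        rw [Finset.mem_filter] at hs
        refine Finset.mem_image.2 ⟨_, Finset.mem_image_of_mem _
          (Finset.mem_range.2 (show s.toNat < _ by omega)), ?_⟩
        funext i
        have hi := i.2
        simp only [hF, window, shiftWord]
        rw [List.getElem?_take, if_pos hi, List.getElem?_drop,
          show ((i : ℕ) : ℤ) + s = ((s.toNat + i : ℕ) : ℤ) by omega, optionAt_natCast]
      have h2 := numDistinctSubstr_le_mul_deltaQ w (k := 3 * l) (by omega) hle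
      have h3 : (numDistinctSubstr w (3 * l) : ℝ) ≤ ((3 * l : ℕ) : ℝ) * ((deltaQ w : ℚ) : ℝ) := by
        exact_mod_cast h2
      push_cast at h3
      exact (Nat.cast_le.2 h1).trans h3
    · have : I = ∅ := by
        apply Finset.filter_false_of_mem
        intro s _
        omega
      rw [this]
      simp only [Finset.image_empty, Finset.card_empty, Nat.cast_zero]
      positivity
  have h1 : ((Finset.Ico (-(l : ℤ)) 0).image F).card ≤ l :=
    Finset.card_image_le.trans (by simp)
  have h2 : ((Finset.Ico ((w.length : ℤ) - 3 * l) w.length).image F).card ≤ 3 * l :=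
    Finset.card_image_le.trans (by simp)
  have h3 := (Finset.card_le_card hcover).trans ((Finset.card_union_le _ _).trans
    (Nat.add_le_add h1 ((Finset.card_union_le _ _).trans (Nat.add_le_add_right h2 _))))
  have h4 : ((((Finset.Ico (-(l : ℤ)) w.length).image F).card : ℕ) : ℝ) ≤
      l + (3 * l + (I.image F).card) := by exact_mod_cast h3
  have hl' : (0 : ℝ) < l := by exact_mod_cast hl
  nlinarith

/-- Distinct Lyndon factors of length about `l` have distinct windows at all offsets below `l`. -/
lemma card_factors_at_scale_le [LinearOrder α] {w : List α} (hw : 0 < w.length) {l : ℕ}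
    (hl : 0 < l) :
    (((lyndonFactorization w).toFinset.filter
      (fun L => l ≤ L.length ∧ L.length < 2 * l)).card : ℝ) ≤ 7 * ((deltaQ w : ℚ) : ℝ) := by
  classical
  set d : α := w[0]
  set S := (lyndonFactorization w).toFinset.filter (fun L => l ≤ L.length ∧ L.length < 2 * l)
    with hS
  have hex := fun (L : List α) (h : L ∈ lyndonFactorization w) => exists_start_of_mem d h
  choose! s hs using hex
  set F : ℤ → Fin (3 * l) → Option α := fun s => window (3 * l) (shiftWord s (optionAt w)) with hF
  have hmem : ∀ L ∈ S, L ∈ lyndonFactorization w ∧ l ≤ L.length ∧ L.length < 2 * l := by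
    intro L hL
    simpa [hS] using hL
  have main : ∀ L ∈ S, ∀ L' ∈ S, ∀ o o' : ℕ, o < l → o' < l → o ≤ o' →
      (o = o' → L'.length ≤ L.length) → F (s L - o) = F (s L' - o') → L = L' ∧ o = o' := by
    intro L hL L' hL' o o' ho ho' hoo hlen heq
    obtain ⟨hL, hLl, hL2⟩ := hmem L hL
    obtain ⟨hL', hLl', hL2'⟩ := hmem L' hL'
    obtain ⟨h1, h2, h3, -, -⟩ := hs L hL
    obtain ⟨h1', h2', h3', h4', h5'⟩ := hs L' hL'
    have hpt : ∀ k < L.length, optionAt w ((s L' : ℤ) - o' + o + k) = L[k]? := by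
      intro k hk
      have := congrFun heq ⟨o + k, by omega⟩
      simp only [hF, window, shiftWord] at this
      rw [← h2 k hk, ← optionAt_natCast w (s L + k)]
      convert this.symm using 2 <;> push_cast <;> ring
    have hge : (0 : ℤ) ≤ (s L' : ℤ) - o' + o := by
      by_contra hcon
      have := hpt 0 (by omega)
      rw [optionAt, if_neg (by omega), List.getElem?_eq_getElem (by omega)] at this
      exact absurd this (by simp)
    obtain ⟨a, ha⟩ := Int.eq_ofNat_of_zero_le hge
    have hpt' : ∀ k < L.length, w[a + k]? = L[k]? := by
      intro k hk
      rw [← hpt k hk, ha, ← optionAt_natCast]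
      rfl
    have hend : a + L.length ≤ w.length := by
      have := hpt' (L.length - 1) (by omega)
      rw [List.getElem?_eq_getElem (by omega : L.length - 1 < L.length)] at this
      have := (List.getElem?_eq_some_iff.1 this).1
      omega
    have hLyn : LyndonOn (fun i => w.getD i d) a (a + L.length) := by
      refine h3.transfer fun k hk => ?_
      simp only [List.getD_eq_getElem?_getD]
      rw [h2 k hk, hpt' k hk]
    have hoo' : o = o' := by
      by_contra hne
      exact h5' a (a + L.length) (by omega) (by omega) hend hLyn
    have has : a = s L' := by omega
    subst hoo'
    have hLL : L.length = L'.length := by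
      by_contra hne
      have := hlen rfl
      exact h4' (a + L.length) (by omega) hend (has ▸ hLyn)
    refine ⟨List.ext_getElem? fun k => ?_, rfl⟩
    rcases lt_or_ge k L.length with hk | hk
    · rw [← hpt' k hk, ← h2' k (by omega), has]
    · rw [List.getElem?_eq_none hk, List.getElem?_eq_none (by omega)]
  have hcard : S.card * l ≤ ((Finset.Ico (-(l : ℤ)) w.length).image F).card := by
    refine (by rw [Finset.card_product, Finset.card_range] :
      S.card * l = (S ×ˢ Finset.range l).card).trans_le ?_
    apply Finset.card_le_card_of_injOn (fun e => F (s e.1 - e.2))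
    · rintro ⟨L, o⟩ he
      simp only [Finset.coe_product, Set.mem_prod, Finset.mem_coe, Finset.mem_range] at he
      have h1 := (hs L (hmem L he.1).1).1
      have h2 := (hmem L he.1).2.1
      exact Finset.mem_coe.2 (Finset.mem_image_of_mem _ (Finset.mem_Ico.2
        ⟨by dsimp only; omega, by dsimp only; omega⟩))
    · rintro ⟨L, o⟩ he ⟨L', o'⟩ he' heq
      simp only [Finset.coe_product, Set.mem_prod, Finset.mem_coe, Finset.mem_range] at he he'
      have hor : (o ≤ o' ∧ (o = o' → L'.length ≤ L.length)) ∨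
          (o' ≤ o ∧ (o' = o → L.length ≤ L'.length)) := by omega
      rcases hor with ⟨h1, h2⟩ | ⟨h1, h2⟩
      · obtain ⟨rfl, rfl⟩ := main L he.1 L' he'.1 o o' he.2 he'.2 h1 h2 heq
        rfl
      · obtain ⟨rfl, rfl⟩ := main L' he'.1 L he.1 o' o he'.2 he.2 h1 h2 heq.symm
        rfl
  have hl' : (0 : ℝ) < l := by exact_mod_cast hl
  have h1 : (S.card : ℝ) * l ≤ l * (7 * ((deltaQ w : ℚ) : ℝ)) :=
    le_trans (by exact_mod_cast hcard) (card_image_windows_le hw hl)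
  nlinarith

lemma length_le_of_mem_lyndonFactorization [LinearOrder α] {w L : List α}
    (h : L ∈ lyndonFactorization w) : L.length ≤ w.length := by
  conv_rhs => rw [← flatten_lyndonFactorization w]
  exact (List.sublist_flatten_of_mem h).length_le

lemma card_toFinset_lyndonFactorization_le [LinearOrder α] {w : List α} (hw : 0 < w.length) :
    ((lyndonFactorization w).toFinset.card : ℝ) ≤
      (Nat.log 2 w.length + 1) * (7 * ((deltaQ w : ℚ) : ℝ)) := by
  set S := (lyndonFactorization w).toFinset with hS
  have hcover : S ⊆ (Finset.range (Nat.log 2 w.length + 1)).biUnion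
      (fun j => S.filter (fun L => 2 ^ j ≤ L.length ∧ L.length < 2 * 2 ^ j)) := by
    intro L hL
    have hmem := List.mem_toFinset.1 hL
    have hpos := (List.length_pos_of_ne_nil (isLyndon_of_mem hmem).1).ne'
    refine Finset.mem_biUnion.2 ⟨Nat.log 2 L.length, Finset.mem_range.2 ?_,
      Finset.mem_filter.2 ⟨hL, Nat.pow_log_le_self 2 hpos, ?_⟩⟩
    · exact Nat.lt_succ_of_le (Nat.log_mono_right (length_le_of_mem_lyndonFactorization hmem))
    · have := Nat.lt_pow_succ_log_self (b := 2) (by norm_num) L.length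
      rw [Nat.succ_eq_add_one, pow_succ] at this
      omega
  calc (S.card : ℝ) ≤ ((∑ j ∈ Finset.range (Nat.log 2 w.length + 1),
        (S.filter (fun L => 2 ^ j ≤ L.length ∧ L.length < 2 * 2 ^ j)).card : ℕ) : ℝ) := by
        exact_mod_cast (Finset.card_le_card hcover).trans Finset.card_biUnion_le
    _ ≤ ∑ j ∈ Finset.range (Nat.log 2 w.length + 1), 7 * ((deltaQ w : ℚ) : ℝ) := by
        push_cast
        exact Finset.sum_le_sum fun j _ => card_factors_at_scale_le hw (by positivity)
    _ = _ := by rw [Finset.sum_const, Finset.card_range, nsmul_eq_mul]; push_cast; ring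

/-! ### Periodic words and the order of rotations -/

/-- The bi-infinite periodic word `…xxx…` aligned at the origin. -/
def periodicWord (d : α) (x : List α) : ℤ → α := fun k => x.getD (k % x.length).toNat d

lemma periodicWord_natCast (d : α) (x : List α) (k : ℕ) :
    periodicWord d x k = x.getD (k % x.length) d := rfl

lemma periodicWord_congr (d : α) (x : List α) {j k : ℤ} (h : (x.length : ℤ) ∣ j - k) :
    periodicWord d x j = periodicWord d x k := by
  unfold periodicWord
  rw [Int.emod_eq_emod_iff_emod_sub_eq_zero.2 (Int.emod_eq_zero_of_dvd h)]

lemma periodicWord_iterate_rot (d : α) {x : List α} (hx : x ≠ []) (i : ℕ) :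
    periodicWord d (rot^[i] x) = shiftWord i (periodicWord d x) := by
  funext k
  have hpos : (0 : ℤ) < x.length := by exact_mod_cast List.length_pos_of_ne_nil hx
  have h0 := Int.emod_nonneg k hpos.ne'
  have h1 := Int.emod_lt_of_pos k hpos
  calc periodicWord d (rot^[i] x) k = (rot^[i] x).getD (k % x.length).toNat d := by
        rw [periodicWord, length_iterate_rot]
    _ = periodicWord d x (((k % x.length).toNat + i : ℕ) : ℤ) := by
        rw [getD_iterate_rot _ _ _ (by omega), periodicWord_natCast]
    _ = _ := by
        apply periodicWord_congr
        rw [Nat.cast_add, Int.toNat_of_nonneg h0, add_sub_add_right_eq_sub]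
        exact (Int.mod_modEq k x.length).symm.dvd

lemma getLast?_eq_periodicWord (d : α) {x : List α} (hx : x ≠ []) :
    x.getLast? = some (periodicWord d x (-1)) := by
  have hpos := List.length_pos_of_ne_nil hx
  rw [periodicWord_congr d x (k := ((x.length - 1 : ℕ) : ℤ)) ⟨-1, by omega⟩, periodicWord_natCast,
    Nat.mod_eq_of_lt (by omega), List.getD_eq_getElem _ _ (by omega), List.getLast?_eq_getElem?,
    List.getElem?_eq_getElem]

lemma length_listPow (x : List α) (n : ℕ) : (listPow x n).length = n * x.length := by
  induction n with
  | zero => simp [listPow]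
  | succ n ih => rw [listPow, List.length_append, ih]; ring

lemma getD_listPow (d : α) (x : List α) {n k : ℕ} (hk : k < n * x.length) :
    (listPow x n).getD k d = periodicWord d x k := by
  rw [periodicWord_natCast]
  induction n generalizing k with
  | zero => simp at hk
  | succ n ih =>
    rw [listPow]
    rcases lt_or_ge k x.length with h | h
    · rw [List.getD_append _ _ _ _ h, Nat.mod_eq_of_lt h]
    · rw [List.getD_append_right _ _ _ _ h, ih (by rw [add_mul] at hk; omega),
        ← Nat.mod_eq_sub_mod h]

/-- Lexicographic comparison of the right-infinite halves of two words. -/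
def LexLE [LinearOrder α] (f g : ℤ → α) : Prop :=
  ∀ k : ℕ, (∀ i : ℕ, i < k → f i = g i) → f k ≤ g k

lemma LexLE.eq_of_between [LinearOrder α] {f g h : ℤ → α} (hfg : LexLE f g) (hgh : LexLE g h)
    (L : ℕ) (hL : ∀ k : ℕ, k < L → f k = h k) : ∀ k : ℕ, k < L → f k = g k := by
  intro k
  induction k using Nat.strong_induction_on with
  | _ k ih =>
    intro hk
    have hlt : ∀ i : ℕ, i < k → f i = g i := fun i hi => ih i hi (hi.trans hk)
    refine le_antisymm (hfg k hlt) ?_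
    rw [hL k hk]
    exact hgh k fun i hi => (hlt i hi).symm.trans (hL i (hi.trans hk))

lemma LexLE.trans [LinearOrder α] {f g h : ℤ → α} (hfg : LexLE f g) (hgh : LexLE g h) :
    LexLE f h := by
  intro k hk
  have h1 := hfg.eq_of_between hgh k hk
  exact (hfg k h1).trans (hgh k fun i hi => (h1 i hi).symm.trans (hk i hi))

lemma LexLE.total [LinearOrder α] (f g : ℤ → α) : LexLE f g ∨ LexLE g f := by
  by_contra! hcon
  simp only [LexLE, not_forall, not_le] at hcon
  obtain ⟨⟨k, hk, hlt⟩, ⟨k', hk', hlt'⟩⟩ := hcon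
  rcases lt_trichotomy k k' with h | rfl | h
  · exact hlt.ne (hk' k h)
  · exact lt_asymm hlt hlt'
  · exact hlt'.ne (hk k' h)

lemma periodicWord_eq_of_agree (d : α) {x y : List α} (hx : x ≠ []) (hy : y ≠ [])
    (h : ∀ k : ℕ, k < x.length * y.length → periodicWord d x k = periodicWord d y k) :
    periodicWord d x = periodicWord d y := by
  have hpos : (0 : ℤ) < (x.length * y.length : ℕ) := by
    exact_mod_cast Nat.mul_pos (List.length_pos_of_ne_nil hx) (List.length_pos_of_ne_nil hy)
  funext z
  set M : ℤ := ((x.length * y.length : ℕ) : ℤ) with hM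
  have h0 := Int.emod_nonneg z hpos.ne'
  have h1 := Int.emod_lt_of_pos z hpos
  have hdvd : M ∣ z - z % M := (Int.mod_modEq z M).dvd
  have e := h (z % M).toNat (by omega)
  rw [Int.toNat_of_nonneg h0] at e
  rw [periodicWord_congr d x ((Dvd.intro _ (by rw [hM, Nat.cast_mul])).trans hdvd), e]
  exact (periodicWord_congr d y ((Dvd.intro_left _ (by rw [hM, Nat.cast_mul])).trans hdvd)).symm

lemma omegaLE_iff_lexLE [LinearOrder α] (d : α) {x y : List α} (hx : x ≠ []) (hy : y ≠ []) :
    omegaLE x y ↔ LexLE (periodicWord d x) (periodicWord d y) := by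
  have hlx : (listPow x y.length).length = x.length * y.length := by
    rw [length_listPow, mul_comm]
  have hly : (listPow y x.length).length = x.length * y.length := length_listPow _ _
  have gx : ∀ k < x.length * y.length, (listPow x y.length).getD k d = periodicWord d x k :=
    fun k hk => getD_listPow d x (by rwa [mul_comm])
  have gy : ∀ k < x.length * y.length, (listPow y x.length).getD k d = periodicWord d y k :=
    fun k hk => getD_listPow d y hk
  unfold omegaLE
  rw [← not_lt, lt_iff_getD d (hly.trans hlx.symm), hly]
  constructor
  · intro h k hk
    rcases lt_or_ge k (x.length * y.length) with hlt | hge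
    · by_contra hcon
      refine h ⟨k, hlt, fun i hi => ?_, ?_⟩
      · rw [gx i (hi.trans hlt), gy i (hi.trans hlt), hk i hi]
      · rw [gx k hlt, gy k hlt]
        exact not_le.1 hcon
    · rw [periodicWord_eq_of_agree d hx hy fun i hi => hk i (by omega)]
  · rintro h ⟨q, hq, h1, h2⟩
    rw [gx q hq, gy q hq] at h2
    refine (h q fun i hi => ?_).not_gt h2
    rw [← gx i (hi.trans hq), ← gy i (hi.trans hq), h1 i hi]

lemma pairwise_insertionSort_omegaLE [LinearOrder α] (d : α) {l : List (List α)}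
    (hl : ∀ x ∈ l, x ≠ []) :
    (List.insertionSort omegaLE l).Pairwise
      (fun x y => LexLE (periodicWord d x) (periodicWord d y)) := by
  classical
  have e := List.map_insertionSort omegaLE
    (fun x y => LexLE (periodicWord d x) (periodicWord d y)) id l
    (fun a ha b hb => omegaLE_iff_lexLE d (hl a ha) (hl b hb))
  rw [List.map_id, List.map_id] at e
  rw [e]
  have : Std.Total (fun x y : List α => LexLE (periodicWord d x) (periodicWord d y)) :=
    ⟨fun x y => LexLE.total _ _⟩
  have : IsTrans (List α) (fun x y => LexLE (periodicWord d x) (periodicWord d y)) :=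
    ⟨fun x y z => LexLE.trans⟩
  exact List.pairwise_insertionSort _ l

/-! ### The rotations of the Lyndon factors -/

/-- All rotations of all Lyndon factors, with multiplicity. -/
def factorRotations [LinearOrder α] (w : List α) : List (List α) :=
  ((lyndonFactorization w).map rotations).flatten

lemma mem_factorRotations [LinearOrder α] {w x : List α} :
    x ∈ factorRotations w ↔ ∃ L ∈ lyndonFactorization w, ∃ i < L.length, rot^[i] L = x := by
  simp [factorRotations, rotations, eq_comm]

lemma length_factorRotations [LinearOrder α] (w : List α) :
    (factorRotations w).length = w.length := by
  conv_rhs => rw [← flatten_lyndonFactorization w]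
  rw [factorRotations, List.length_flatten, List.length_flatten, List.map_map]
  congr 2
  funext x
  simp [rotations]

lemma ne_nil_of_mem_factorRotations [LinearOrder α] {w x : List α} (h : x ∈ factorRotations w) :
    x ≠ [] := by
  obtain ⟨L, hL, i, hi, rfl⟩ := mem_factorRotations.1 h
  apply List.ne_nil_of_length_pos
  rw [length_iterate_rot]
  omega

lemma length_le_of_mem_factorRotations [LinearOrder α] {w x : List α}
    (h : x ∈ factorRotations w) : x.length ≤ w.length := by
  obtain ⟨L, hL, i, hi, rfl⟩ := mem_factorRotations.1 h
  rw [length_iterate_rot]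
  exact length_le_of_mem_lyndonFactorization hL

open Classical in
/-- The distinct periodic words of the rotations of the Lyndon factors. -/
noncomputable def factorWords [LinearOrder α] (d : α) (w : List α) : Finset (ℤ → α) :=
  ((factorRotations w).map (periodicWord d)).toFinset

lemma mem_factorWords [LinearOrder α] {d : α} {w : List α} {g : ℤ → α} :
    g ∈ factorWords d w ↔ ∃ L ∈ lyndonFactorization w, ∃ i < L.length,
      shiftWord i (periodicWord d L) = g := by
  simp only [factorWords, List.mem_toFinset, List.mem_map, mem_factorRotations]
  constructor
  · rintro ⟨_, ⟨L, hL, i, hi, rfl⟩, rfl⟩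
    exact ⟨L, hL, i, hi, (periodicWord_iterate_rot d (isLyndon_of_mem hL).1 i).symm⟩
  · rintro ⟨L, hL, i, hi, rfl⟩
    exact ⟨_, ⟨L, hL, i, hi, rfl⟩, periodicWord_iterate_rot d (isLyndon_of_mem hL).1 i⟩

lemma periodicWord_mem_factorWords [LinearOrder α] (d : α) {w x : List α}
    (hx : x ∈ factorRotations w) : periodicWord d x ∈ factorWords d w := by
  classical
  rw [factorWords, List.mem_toFinset]
  exact List.mem_map_of_mem hx

lemma card_factorWords_le [LinearOrder α] (d : α) (w : List α) :
    (factorWords d w).card ≤ w.length := by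
  classical
  unfold factorWords
  exact (List.toFinset_card_le _).trans (by rw [List.length_map, length_factorRotations])

lemma shiftWord_mem_factorWords [LinearOrder α] {d : α} {w : List α} {g : ℤ → α}
    (hg : g ∈ factorWords d w) (z : ℤ) : shiftWord z g ∈ factorWords d w := by
  obtain ⟨L, hL, i, hi, rfl⟩ := mem_factorWords.1 hg
  have hpos : (0 : ℤ) < L.length := by omega
  have h0 := Int.emod_nonneg (z + i) hpos.ne'
  have h1 := Int.emod_lt_of_pos (z + i) hpos
  refine mem_factorWords.2 ⟨L, hL, ((z + i) % L.length).toNat, by omega, ?_⟩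
  funext k
  simp only [shiftWord]
  apply periodicWord_congr
  rw [Int.toNat_of_nonneg h0, show k + (z + i) % (L.length : ℤ) - (k + z + i) =
    (z + i) % (L.length : ℤ) - (z + i) by ring]
  exact (Int.mod_modEq (z + i) L.length).symm.dvd

open Classical in
/-- Windows that do not wrap around a Lyndon factor are substrings of `w`, and each distinct factor
contributes at most `K` others. -/
lemma card_image_window_factorWords_le [LinearOrder α] (d : α) {w : List α} {K : ℕ}
    (hK : 0 < K) :
    (((factorWords d w).image (window K)).card : ℝ) ≤
      K * (((deltaQ w : ℚ) : ℝ) + (lyndonFactorization w).toFinset.card) := by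
  set T : Finset (Fin K → α) := ((lyndonFactorization w).toFinset ×ˢ Finset.range K).image
    (fun e => window K (shiftWord ((e.1.length - 1 - e.2 : ℕ) : ℤ) (periodicWord d e.1))) with hT
  have hTcard : T.card ≤ K * (lyndonFactorization w).toFinset.card := by
    refine Finset.card_image_le.trans ?_
    rw [Finset.card_product, Finset.card_range, mul_comm]
  have hwrap : ∀ L ∈ lyndonFactorization w, ∀ i < L.length, L.length < i + K →
      window K (shiftWord (i : ℤ) (periodicWord d L)) ∈ T := by
    intro L hL i hi hiK
    refine Finset.mem_image.2 ⟨(L, L.length - 1 - i), Finset.mem_product.2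
      ⟨List.mem_toFinset.2 hL, Finset.mem_range.2 (by omega)⟩, ?_⟩
    rw [show L.length - 1 - (L.length - 1 - i) = i by omega]
  rcases lt_or_ge w.length K with hlt | hge
  · have hsub : (factorWords d w).image (window K) ⊆ T := by
      intro f hf
      obtain ⟨g, hg, rfl⟩ := Finset.mem_image.1 hf
      obtain ⟨L, hL, i, hi, rfl⟩ := mem_factorWords.1 hg
      have := length_le_of_mem_lyndonFactorization hL
      exact hwrap L hL i hi (by omega)
    have h1 : (((factorWords d w).image (window K)).card : ℝ) ≤
        K * (lyndonFactorization w).toFinset.card := by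
      exact_mod_cast (Finset.card_le_card hsub).trans hTcard
    have h2 : (0 : ℝ) ≤ ((deltaQ w : ℚ) : ℝ) := by
      rcases Nat.eq_zero_or_pos w.length with h | h
      · rw [deltaQ, h]; simp
      · exact zero_le_one.trans (by exact_mod_cast one_le_deltaQ h)
    have h3 : (0 : ℝ) < K := by exact_mod_cast hK
    nlinarith
  · set U : Finset (Fin K → α) := ((Finset.range (w.length - K + 1)).image
      (fun i => (w.drop i).take K)).image (fun x (i : Fin K) => x.getD i d) with hU
    have hUcard : U.card ≤ numDistinctSubstr w K := by
      rw [numDistinctSubstr_eq_card]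
      exact Finset.card_image_le
    have hsub : (factorWords d w).image (window K) ⊆ U ∪ T := by
      intro f hf
      obtain ⟨g, hg, rfl⟩ := Finset.mem_image.1 hf
      obtain ⟨L, hL, i, hi, rfl⟩ := mem_factorWords.1 hg
      rw [Finset.mem_union]
      rcases lt_or_ge L.length (i + K) with h | h
      · exact Or.inr (hwrap L hL i hi h)
      · left
        obtain ⟨s, hs, hsL, -⟩ := exists_start_of_mem d hL
        refine Finset.mem_image.2 ⟨_, Finset.mem_image_of_mem _
          (Finset.mem_range.2 (show s + i < _ by omega)), ?_⟩
        funext k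
        have hk := k.2
        simp only [window, shiftWord]
        rw [← Nat.cast_add, periodicWord_natCast, Nat.mod_eq_of_lt (by omega),
          List.getD_eq_getElem?_getD, List.getD_eq_getElem?_getD, List.getElem?_take, if_pos hk,
          List.getElem?_drop, ← hsL _ (by omega)]
        congr 2
        omega
    have h1 : (((factorWords d w).image (window K)).card : ℝ) ≤
        numDistinctSubstr w K + K * (lyndonFactorization w).toFinset.card := by
      exact_mod_cast (Finset.card_le_card hsub).trans
        ((Finset.card_union_le _ _).trans (Nat.add_le_add hUcard hTcard))
    have h2 : (numDistinctSubstr w K : ℝ) ≤ K * ((deltaQ w : ℚ) : ℝ) := by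
      exact_mod_cast numDistinctSubstr_le_mul_deltaQ w hK hge
    linarith

/-- The sorted list of rotations whose last symbols spell the bijective Burrows–Wheeler
transform. -/
lemma exists_sorted_factorRotations [LinearOrder α] (d : α) (w : List α) :
    (BBWT w).length = w.length ∧ ∃ y : ℕ → List α,
      (∀ p < w.length, y p ∈ factorRotations w) ∧
      (∀ p < w.length, (BBWT w)[p]? = some (periodicWord d (y p) (-1))) ∧
      ∀ p q, p ≤ q → q < w.length → LexLE (periodicWord d (y p)) (periodicWord d (y q)) := by
  have hsorted := pairwise_insertionSort_omegaLE d (l := factorRotations w)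
    fun x hx => ne_nil_of_mem_factorRotations hx
  have hSlen : (List.insertionSort omegaLE (factorRotations w)).length = w.length := by
    rw [List.length_insertionSort, length_factorRotations]
  have hSmem : ∀ x ∈ List.insertionSort omegaLE (factorRotations w), x ∈ factorRotations w :=
    fun x hx => (List.mem_insertionSort _).1 hx
  have hB : BBWT w = (List.insertionSort omegaLE (factorRotations w)).map
      (fun x => periodicWord d x (-1)) := by
    rw [← List.filterMap_eq_map]
    exact List.filterMap_congr fun x hx =>
      getLast?_eq_periodicWord d (ne_nil_of_mem_factorRotations (hSmem x hx))
  generalize List.insertionSort omegaLE (factorRotations w) = S at *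
  refine ⟨by rw [hB, List.length_map, hSlen], fun p => S.getD p [], ?_, ?_, ?_⟩
  · intro p hp
    simp only [List.getD_eq_getElem S [] (hSlen ▸ hp)]
    exact hSmem _ (List.getElem_mem _)
  · intro p hp
    simp only [List.getD_eq_getElem S [] (hSlen ▸ hp)]
    rw [hB, List.getElem?_map, List.getElem?_eq_getElem (by omega)]
    rfl
  · intro p q hpq hq
    rcases hpq.eq_or_lt with rfl | hlt
    · exact fun k _ => le_rfl
    · simp only [List.getD_eq_getElem S [] (hSlen ▸ hq),
        List.getD_eq_getElem S [] (hSlen ▸ hpq.trans_lt hq)]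
      exact List.pairwise_iff_getElem.1 hsorted p q _ _ hlt

/-- The number of runs of the bijective Burrows–Wheeler transform, in terms of `D = δ + m` for
`m` the number of distinct Lyndon factors. -/
lemma card_changes_BBWT_le [LinearOrder α] (w : List α) :
    (((Finset.range ((BBWT w).length - 1)).filter
      (fun p => (BBWT w)[p]? ≠ (BBWT w)[p + 1]?)).card : ℝ) ≤
        (((deltaQ w : ℚ) : ℝ) + (lyndonFactorization w).toFinset.card) *
          (1 + 6 * (2 * Nat.log 2 w.length + 2 : ℕ) * Nat.log 2 w.length) := by
  rcases eq_or_ne w [] with rfl | hw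
  · simp [BBWT, lyndonFactorization, lyndonFactAux, deltaQ]
  have hwpos := List.length_pos_of_ne_nil hw
  obtain ⟨d⟩ : Nonempty α := ⟨w[0]⟩
  obtain ⟨hBlen, y, hget, hBget, hle⟩ := exists_sorted_factorRotations d w
  have hlcp : ∀ p, p + 1 < w.length →
      periodicWord d (y p) (-1) ≠ periodicWord d (y (p + 1)) (-1) →
      ∃ k : ℕ, k < 2 ^ (2 * Nat.log 2 w.length + 2) ∧
        periodicWord d (y p) k ≠ periodicWord d (y (p + 1)) k := by
    intro p hp hne
    by_contra! hcon
    have h1 := hget p (by omega)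
    have h2 := hget (p + 1) hp
    refine hne (congrFun (periodicWord_eq_of_agree d (ne_nil_of_mem_factorRotations h1)
      (ne_nil_of_mem_factorRotations h2) fun k hk => hcon k (hk.trans ?_)) (-1))
    have h3 := Nat.lt_pow_succ_log_self (b := 2) (by norm_num) w.length
    calc _ ≤ w.length * w.length := Nat.mul_le_mul (length_le_of_mem_factorRotations h1)
          (length_le_of_mem_factorRotations h2)
      _ < 2 ^ (Nat.log 2 w.length + 1) * 2 ^ (Nat.log 2 w.length + 1) :=
          Nat.mul_lt_mul'' h3 h3
      _ = 2 ^ (2 * Nat.log 2 w.length + 2) := by rw [← pow_add]; congr 1; omega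
  have key := card_changes_le (factorWords d w) (fun g hg z => shiftWord_mem_factorWords hg z)
    (fun p => periodicWord d (y p)) w.length (2 * Nat.log 2 w.length + 2)
    (((deltaQ w : ℚ) : ℝ) + (lyndonFactorization w).toFinset.card)
    (fun K hK => by convert card_image_window_factorWords_le d hK)
    (fun p hp => periodicWord_mem_factorWords d (hget p hp))
    (fun p q r hpq hqr hr L h =>
      (hle p q hpq (by omega)).eq_of_between (hle q r hqr hr) L h)
    hlcp
  refine le_trans (le_of_eq ?_) (key.trans (mul_le_mul_of_nonneg_left ?_ ?_))
  · rw [hBlen, Nat.cast_inj]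
    congr 1
    ext p
    simp only [Finset.mem_filter, Finset.mem_range]
    refine and_congr_right fun hp => ?_
    rw [hBget p (by omega), hBget (p + 1) (by omega), ne_eq, Option.some_inj]
  · have := Nat.log_mono_right (b := 2) (card_factorWords_le d w)
    gcongr
  · exact add_nonneg (zero_le_one.trans (by exact_mod_cast one_le_deltaQ hwpos))
      (Nat.cast_nonneg _)

/-- there is a constant `C > 0` such that for every string `w` of
length `n ≥ 2`, `δ(BBWT(w)) ≤ C · δ(w) · (log₂ n)⁶`. -/
theorem stmt15 :
    ∃ C : ℝ, 0 < C ∧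
      ∀ (β : Type) [LinearOrder β] (w : List β), 2 ≤ w.length →
        ((deltaQ (BBWT w) : ℚ) : ℝ) ≤
          C * ((deltaQ w : ℚ) : ℝ) * (Real.logb 2 (w.length : ℝ)) ^ 6 := by
  refine ⟨376, by norm_num, fun β _ w hw => ?_⟩
  have hpos : 0 < w.length := by omega
  have hδ : (1 : ℝ) ≤ ((deltaQ w : ℚ) : ℝ) := by exact_mod_cast one_le_deltaQ hpos
  have h1 : ((deltaQ (BBWT w) : ℚ) : ℝ) ≤ 1 + (((Finset.range ((BBWT w).length - 1)).filter
      (fun p => (BBWT w)[p]? ≠ (BBWT w)[p + 1]?)).card : ℝ) := by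
    exact_mod_cast deltaQ_le_one_add_card_changes (BBWT w)
  have h2 := card_changes_BBWT_le w
  have h3 := card_toFinset_lyndonFactorization_le hpos
  have hg : (1 : ℝ) ≤ (Nat.log 2 w.length : ℝ) := by
    exact_mod_cast Nat.log_pos (by norm_num) hw
  have ht : (Nat.log 2 w.length : ℝ) ≤ Real.logb 2 w.length := Real.natLog_le_logb _ _
  push_cast at h2
  set g : ℝ := (Nat.log 2 w.length : ℝ)
  set t : ℝ := Real.logb 2 w.length
  set δ : ℝ := ((deltaQ w : ℚ) : ℝ)
  have hD : δ + (lyndonFactorization w).toFinset.card ≤ 15 * g * δ := by nlinarith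
  have hJ : 1 + 6 * (2 * g + 2) * g ≤ 25 * g ^ 2 := by nlinarith
  have hR : (δ + (lyndonFactorization w).toFinset.card) * (1 + 6 * (2 * g + 2) * g) ≤
      15 * g * δ * (25 * g ^ 2) := mul_le_mul hD hJ (by positivity) (by positivity)
  have hg3 : g ^ 3 ≤ t ^ 6 :=
    (pow_le_pow_left₀ (by positivity) ht 3).trans (pow_le_pow_right₀ (hg.trans ht) (by norm_num))
  have hg1 : 1 ≤ g ^ 3 := one_le_pow₀ hg
  calc _ ≤ 1 + 15 * g * δ * (25 * g ^ 2) := h1.trans (by linarith)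
    _ ≤ 376 * δ * g ^ 3 := by nlinarith
    _ ≤ 376 * δ * t ^ 6 := mul_le_mul_of_nonneg_left hg3 (by positivity)
end

section
/- For every integer k ≥ 2 and every position i with 0 ≤ i < f_k, the Zeckendorf bit strings satisfy: Z_k(Ψ_{F_k}(i)) = rot(Z_k(i)) if F_k[i] = a, and Z_k(Ψ_{F_k}(i)) = rot²(Z_k(i)) if F_k[i] = b, where rot denotes the left cyclic rotation of a length-k bit string by one position and rot² its twofold iterate. -/
/-! Basic definitions: strings as `List α`, rotations, runs, BWT, Lyndon
factorization, ω-order, bijective BWT, and Fibonacci words. -/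

variable {α : Type*}

/-- `rank_c(i, x)`: the number of occurrences of `c` in `x[0..i)`. -/
def rankc [DecidableEq α] (c : α) (i : ℕ) (x : List α) : ℕ :=
  ((x.take i).filter (fun d => d == c)).length

/-- The number of symbols of `x` strictly smaller than `c`. -/
def countLt [LinearOrder α] (c : α) (x : List α) : ℕ :=
  (x.filter (fun d => decide (d < c))).length

/-- The LF mapping `Ψ_x` of a string `x` over `Fin 2`: `Ψ_x(i)` is the unique
`j` with `s[j] = x[i]` and `rank_{x[i]}(j, s) = rank_{x[i]}(i, x)`, where `s`
is the sorted copy of `x`; equivalently `Ψ_x(i) = |{p : x[p] < x[i]}| +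
rank_{x[i]}(i, x)`. -/
def LF (x : List (Fin 2)) (i : ℕ) : ℕ :=
  countLt (x.getD i 0) x + rankc (x.getD i 0) i x

/-- `zeckRev m i` lists the Zeckendorf bits `Z(i)[m-1], …, Z(i)[0]` (most
significant first), computed greedily; the bit at index `j` stands for the
Fibonacci number `f_{j+1} = Nat.fib (j+2)`. -/
def zeckRev : ℕ → ℕ → List Bool
  | 0, _ => []
  | m+1, i =>
      if Nat.fib (m + 2) ≤ i then true :: zeckRev m (i - Nat.fib (m + 2))
      else false :: zeckRev m i

/-- `Z_k(i)`: the length-`k` prefix `Z(i)[0..k-1]` of the Zeckendorf bit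
string of `i`. -/
def Zbits (k i : ℕ) : List Bool := (zeckRev k i).reverse

/-- The value of a most-significant-first bit string in which the bit followed by `n` bits
has weight `Nat.fib (n + s)`. -/
def fibVal (s : ℕ) : List Bool → ℕ
  | [] => 0
  | c :: t => (if c then Nat.fib (t.length + s) else 0) + fibVal s t

/-- No two consecutive bits are set. -/
def NoAdjacentOnes (l : List Bool) : Prop := l.IsChain (fun a b => ¬(a = true ∧ b = true))

theorem fibVal_concat (s : ℕ) (l : List Bool) (c : Bool) :
    fibVal s (l ++ [c]) = fibVal (s + 1) l + if c then Nat.fib s else 0 := by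
  induction l with
  | nil => simp [fibVal]
  | cons d t ih =>
    simp only [List.cons_append, fibVal, ih, List.length_append, List.length_singleton]
    rw [show t.length + 1 + s = t.length + (s + 1) by omega]
    omega

theorem length_zeckRev (m i : ℕ) : (zeckRev m i).length = m := by
  induction m generalizing i with
  | zero => rfl
  | succ m ih => unfold zeckRev; split_ifs <;> simp [ih]

theorem zeckRev_succ_of_lt {m i : ℕ} (h : i < Nat.fib (m + 2)) :
    zeckRev (m + 1) i = false :: zeckRev m i := by
  rw [zeckRev, if_neg (by omega)]

theorem zeckRev_succ_fib_add (m i : ℕ) :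
    zeckRev (m + 1) (Nat.fib (m + 2) + i) = true :: zeckRev m i := by
  rw [zeckRev, if_pos (by omega), Nat.add_sub_cancel_left]

theorem noAdjacentOnes_zeckRev (m i : ℕ) (h : i < Nat.fib (m + 2)) :
    NoAdjacentOnes (zeckRev m i) := by
  induction m using Nat.strong_induction_on generalizing i with
  | _ m ih =>
    match m with
    | 0 => simp [zeckRev, NoAdjacentOnes]
    | 1 =>
      have : zeckRev 1 i = [true] ∨ zeckRev 1 i = [false] := by
        simp only [zeckRev]; split_ifs <;> simp
      rcases this with h | h <;> simp [h, NoAdjacentOnes]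
    | m + 2 =>
      rcases lt_or_ge i (Nat.fib (m + 1 + 2)) with hlt | hge
      · have := ih (m + 1) (by omega) i hlt
        rw [zeckRev_succ_of_lt hlt]
        cases hz : zeckRev (m + 1) i with
        | nil => simp [NoAdjacentOnes]
        | cons c t => rw [hz] at this; simpa [NoAdjacentOnes] using this
      · obtain ⟨j, rfl⟩ := Nat.exists_eq_add_of_le hge
        have hj : j < Nat.fib (m + 2) := by
          have : Nat.fib (m + 4) = Nat.fib (m + 2) + Nat.fib (m + 3) := Nat.fib_add_two
          simp only [show m + 2 + 2 = m + 4 by rfl, show m + 1 + 2 = m + 3 by rfl] at h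
          omega
        have := ih m (by omega) j hj
        rw [zeckRev_succ_fib_add, zeckRev_succ_of_lt hj]
        cases hz : zeckRev m j with
        | nil => simp [NoAdjacentOnes]
        | cons c t => rw [hz] at this; simpa [NoAdjacentOnes] using this

theorem fibVal_two_lt (l : List Bool) (h : NoAdjacentOnes l) :
    fibVal 2 l < Nat.fib (l.length + 2) := by
  match l with
  | [] => simp [fibVal]
  | false :: t =>
    have := fibVal_two_lt t h.of_cons
    have hm : Nat.fib (t.length + 2) ≤ Nat.fib (t.length + 1 + 2) := Nat.fib_mono (by omega)
    simp only [fibVal, List.length_cons]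
    simp
    omega
  | [true] => simp [fibVal, Nat.fib_add_two]
  | true :: true :: t => simp [NoAdjacentOnes] at h
  | true :: false :: t =>
    have := fibVal_two_lt t h.of_cons.of_cons
    have hf : Nat.fib (t.length + 4) = Nat.fib (t.length + 2) + Nat.fib (t.length + 3) :=
      Nat.fib_add_two
    simp only [fibVal, List.length_cons]
    simp [Nat.add_assoc]
    omega

theorem zeckRev_fibVal (l : List Bool) (h : NoAdjacentOnes l) :
    zeckRev l.length (fibVal 2 l) = l := by
  induction l with
  | nil => rfl
  | cons c t ih =>
    have ht : NoAdjacentOnes t := h.of_cons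
    cases c with
    | true =>
      simp only [fibVal, List.length_cons, if_true]
      rw [zeckRev_succ_fib_add, ih ht]
    | false =>
      have := fibVal_two_lt t ht
      simp only [fibVal, List.length_cons, Bool.false_eq_true, if_false, Nat.zero_add]
      rw [zeckRev_succ_of_lt this, ih ht]

theorem fibWord_add_two (k : ℕ) : fibWord (k + 2) = fibWord (k + 1) ++ fibWord k := rfl

theorem length_fibWord (k : ℕ) : (fibWord k).length = Nat.fib (k + 1) := by
  induction k using Nat.twoStepInduction with
  | zero => rfl
  | one => rfl
  | more k h0 h1 =>
    rw [fibWord_add_two, List.length_append, h0, h1, Nat.fib_add_two (n := k + 1)]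
    omega

theorem length_filter_zero_fibWord_succ (k : ℕ) :
    ((fibWord (k + 1)).filter (fun d => d == 0)).length = Nat.fib (k + 1) := by
  induction k using Nat.twoStepInduction with
  | zero => rfl
  | one => rfl
  | more k h0 h1 =>
    rw [fibWord_add_two, List.filter_append, List.length_append, h0, h1,
      Nat.fib_add_two (n := k + 1)]
    omega

theorem length_filter_one_fibWord_succ (k : ℕ) :
    ((fibWord (k + 1)).filter (fun d => d == 1)).length = Nat.fib k := by
  induction k using Nat.twoStepInduction with
  | zero => rfl
  | one => rfl
  | more k h0 h1 =>
    rw [fibWord_add_two, List.filter_append, List.length_append, h0, h1, Nat.fib_add_two]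
    omega

theorem rankc_append_of_le (c : Fin 2) {i : ℕ} {x : List (Fin 2)} (y : List (Fin 2))
    (h : i ≤ x.length) : rankc c i (x ++ y) = rankc c i x := by
  rw [rankc, List.take_append_of_le_length h, rankc]

theorem rankc_append_length_add (c : Fin 2) (i : ℕ) (x y : List (Fin 2)) :
    rankc c (x.length + i) (x ++ y) = (x.filter (fun d => d == c)).length + rankc c i y := by
  simp [rankc, List.take_append, List.take_of_length_le]

/-- Letter counts in prefixes of a Fibonacci word, and its letters, read off from the Zeckendorf
representation of the position. -/
theorem fibWord_prefix (k i : ℕ) (h : i < Nat.fib (k + 1)) :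
    rankc 0 i (fibWord k) = fibVal 1 (zeckRev k i) ∧
    rankc 1 i (fibWord k) = fibVal 0 (zeckRev k i) ∧
    (fibWord k).getD i 0 = if (zeckRev k i).getLastD true then 1 else 0 := by
  induction k using Nat.twoStepInduction generalizing i with
  | zero =>
    obtain rfl : i = 0 := by simpa using h
    simp [rankc, zeckRev, fibVal, fibWord, fibWordG]
  | one =>
    obtain rfl : i = 0 := by simpa using h
    simp [rankc, zeckRev, fibVal, fibWord, fibWordG]
  | more k h0 h1 =>
    have hl := length_fibWord (k + 1)
    rw [zeckRev_succ_of_lt h, fibWord_add_two]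
    rcases lt_or_ge i (Nat.fib (k + 2)) with hlt | hge
    · obtain ⟨ha, hb, hc⟩ := h1 i hlt
      have hlt' : i < (fibWord (k + 1)).length := by rw [hl]; exact hlt
      rw [rankc_append_of_le _ _ hlt'.le, rankc_append_of_le _ _ hlt'.le, ha, hb,
        List.getD_append _ _ _ _ hlt', hc, zeckRev_succ_of_lt hlt]
      simp [fibVal]
    · obtain ⟨j, rfl⟩ := Nat.exists_eq_add_of_le hge
      have hj : j < Nat.fib (k + 1) := by
        have : Nat.fib (k + 3) = Nat.fib (k + 1) + Nat.fib (k + 2) := Nat.fib_add_two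
        simp only [show k + 2 + 1 = k + 3 by rfl] at h
        omega
      obtain ⟨ha, hb, hc⟩ := h0 j hj
      rw [zeckRev_succ_fib_add]
      have hl' : Nat.fib (k + 2) = (fibWord (k + 1)).length := hl.symm
      rw [hl', rankc_append_length_add, rankc_append_length_add, ha, hb,
        List.getD_append_right _ _ _ _ (by omega), Nat.add_sub_cancel_left, hc,
        length_filter_zero_fibWord_succ, length_filter_one_fibWord_succ]
      simp [fibVal, length_zeckRev, List.getLast?_cons]

theorem LF_of_getD_eq_zero {x : List (Fin 2)} {i : ℕ} (h : x.getD i 0 = 0) :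
    LF x i = rankc 0 i x := by
  rw [LF, h]
  simp [countLt]

theorem LF_of_getD_eq_one {x : List (Fin 2)} {i : ℕ} (h : x.getD i 0 = 1) :
    LF x i = (x.filter (fun d => d == 0)).length + rankc 1 i x := by
  have hd : (fun d : Fin 2 => decide (d < 1)) = fun d => d == 0 := by decide
  rw [LF, h, countLt, hd]

/-- for `k ≥ 2` and `0 ≤ i < f_k`,
`Z_k(Ψ_{F_k}(i)) = rot(Z_k(i))` if `F_k[i] = a`, and
`Z_k(Ψ_{F_k}(i)) = rot²(Z_k(i))` if `F_k[i] = b`. -/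
theorem stmt18 (k i : ℕ) (hk : 2 ≤ k) (hi : i < (fibWord k).length) :
    ((fibWord k).getD i 0 = 0 →
      Zbits k (LF (fibWord k) i) = rot^[1] (Zbits k i)) ∧
    ((fibWord k).getD i 0 = 1 →
      Zbits k (LF (fibWord k) i) = rot^[2] (Zbits k i)) := by
  rw [length_fibWord] at hi
  obtain ⟨ha, hb, hc⟩ := fibWord_prefix k i hi
  obtain ⟨n, rfl⟩ := Nat.exists_eq_add_of_le' hk
  have hch : NoAdjacentOnes (zeckRev (n + 2) i) :=
    noAdjacentOnes_zeckRev _ _ (hi.trans_le (Nat.fib_mono (by omega)))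
  have hhead : zeckRev (n + 2) i = false :: zeckRev (n + 1) i := zeckRev_succ_of_lt hi
  have hlen := length_zeckRev (n + 2) i
  obtain ⟨u, y, hu⟩ : ∃ u y, zeckRev (n + 2) i = u ++ [y] :=
    ⟨_, _, (List.dropLast_append_getLast (by simp [hhead])).symm⟩
  obtain ⟨w, x, rfl⟩ : ∃ w x, u = w ++ [x] := by
    refine ⟨_, _, (List.dropLast_append_getLast (l := u) ?_).symm⟩
    rintro rfl
    simp [hu] at hlen
  unfold Zbits
  rw [hu] at hch hlen hhead hc ha hb ⊢
  constructor
  · intro h0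
    have hy : y = false := by
      rw [h0, List.getLastD_concat] at hc
      cases y <;> simp at hc ⊢
    subst hy
    have hv : NoAdjacentOnes (false :: (w ++ [x])) := by
      have : NoAdjacentOnes (w ++ [x]) := hch.left_of_append
      cases w with
      | nil => simp [NoAdjacentOnes]
      | cons c t => simpa [NoAdjacentOnes] using this
    have hz := zeckRev_fibVal _ hv
    have hval : LF (fibWord (n + 2)) i = fibVal 2 (false :: (w ++ [x])) := by
      rw [LF_of_getD_eq_zero h0, ha, fibVal_concat]
      simp [fibVal]
    have hn : (false :: (w ++ [x])).length = n + 2 := by simpa using hlen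
    rw [hn, ← hval] at hz
    rw [hz]
    simp [rot]
  · intro h1
    have hy : y = true := by
      rw [h1, List.getLastD_concat] at hc
      cases y <;> simp at hc ⊢
    subst hy
    have hx : x = false := by
      have : NoAdjacentOnes ([x] ++ [true]) := by
        rw [List.append_assoc] at hch
        exact hch.right_of_append
      simpa [NoAdjacentOnes] using this
    subst hx
    have hw : NoAdjacentOnes w := hch.left_of_append.left_of_append
    have hv : NoAdjacentOnes (false :: true :: w) := by
      cases w with
      | nil => simp [NoAdjacentOnes]
      | cons c t =>
        obtain rfl : c = false := by simpa using (List.cons.inj hhead).1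
        simpa [NoAdjacentOnes] using hw
    have hwl : w.length = n := by simpa using hlen
    have hz := zeckRev_fibVal _ hv
    have hval : LF (fibWord (n + 2)) i = fibVal 2 (false :: true :: w) := by
      rw [LF_of_getD_eq_one h1, hb, fibVal_concat, fibVal_concat,
        length_filter_zero_fibWord_succ]
      simp [fibVal, hwl]
    have hn : (false :: true :: w).length = n + 2 := by simpa using hlen
    rw [hn, ← hval] at hz
    rw [hz]
    simp [rot]
end
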